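/- arXiv:2111.03257 — 3 statements merged into one kernel-verified Lean document; each statement's English description precedes it below -/
import Mathlib

section
/- There is an absolute constant c > 0 with the following property. For all n ∈ ℕ with n ≥ 2 and all reals ε, δ with (log₂ n)/n < ε < 10⁻⁶ and 0 < δ < 0.1·ε, every (ε,δ)-differentially private randomized algorithm A : I_{≤n} → PMF(I) satisfies max_{p ∈ I_{≤n}} E_{q∼A(p)}[‖q − p‖₁] ≥ c·√((n/ε)·log₂(1/ε)). -/
open scoped ENNReal

/-- An integer partition: a nonincreasing sequence `p : ℕ → ℕ` with finite support. -/
def IsPartition (p : ℕ → ℕ) : Prop :=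
  Antitone p ∧ (Function.support p).Finite

/-- The size of a partition, `∑_{i ≥ 1} p_i`. -/
noncomputable def psize (p : ℕ → ℕ) : ℕ := ∑ᶠ i : ℕ, p i

/-- The ℓ1 distance `‖p − q‖₁ = ∑_{i} |p_i − q_i|` (differences taken in ℤ). -/
noncomputable def l1 (p q : ℕ → ℕ) : ℕ :=
  ∑ᶠ i : ℕ, ((p i : ℤ) - (q i : ℤ)).natAbs

/-- `I`: the set of all integer partitions. -/
def IntPart : Type := {p : ℕ → ℕ // IsPartition p}

/-- `I_{≤ n}`: integer partitions of size at most `n`. -/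
def PartLE (n : ℕ) : Type := {p : ℕ → ℕ // IsPartition p ∧ psize p ≤ n}

lemma l1_eq_sum (p q : ℕ → ℕ) (N : ℕ) (h : ∀ i, N ≤ i → p i = q i) :
    l1 p q = ∑ i ∈ Finset.range N, ((p i : ℤ) - (q i : ℤ)).natAbs := by
  unfold l1
  apply finsum_eq_sum_of_support_subset
  intro i hi
  simp only [Finset.coe_range, Set.mem_Iio]
  by_contra hc
  exact hi (by simp [h i (not_lt.mp hc)])

lemma psize_eq_sum (p : ℕ → ℕ) (N : ℕ) (h : ∀ i, N ≤ i → p i = 0) :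
    psize p = ∑ i ∈ Finset.range N, p i := by
  unfold psize
  apply finsum_eq_sum_of_support_subset
  intro i hi
  simp only [Finset.coe_range, Set.mem_Iio]
  by_contra hc
  exact hi (h i (not_lt.mp hc))

lemma IsPartition.exists_bound {p : ℕ → ℕ} (h : IsPartition p) :
    ∃ N, ∀ i, N ≤ i → p i = 0 := by
  obtain ⟨N, hN⟩ := h.2.bddAbove
  refine ⟨N + 1, fun i hi => ?_⟩
  by_contra hc
  have := hN (show i ∈ Function.support p from hc)
  omega

lemma isPartition_of_bound {p : ℕ → ℕ} (h : Antitone p) (N : ℕ)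
    (hN : ∀ i, N ≤ i → p i = 0) : IsPartition p := by
  refine ⟨h, (Set.finite_Iio N).subset fun i hi => ?_⟩
  simp only [Set.mem_Iio]
  by_contra hc
  exact hi (hN i (not_lt.mp hc))

/-- Group privacy along a monotone chain of partitions. -/
lemma group_privacy {n : ℕ} {ε δ : ℝ} (hε : 0 ≤ ε) (hδ : 0 ≤ δ) (P : PartLE n → ℝ)
    (hP0 : ∀ p, 0 ≤ P p)
    (hP : ∀ p p' : PartLE n, l1 p.1 p'.1 ≤ 1 → P p ≤ Real.exp ε * P p' + δ) (r : ℕ) :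
    ∀ p p' : PartLE n, (∀ i, p.1 i ≤ p'.1 i) → l1 p'.1 p.1 ≤ r →
      P p' ≤ Real.exp (r * ε) * (P p + r * δ) := by
  induction r with
  | zero =>
    intro p p' hle hl
    obtain ⟨N, hN⟩ := p'.2.1.exists_bound
    have hz : ∀ i, N ≤ i → p'.1 i = p.1 i := fun i hi => by
      have := hN i hi; have := hle i; omega
    rw [l1_eq_sum _ _ N hz] at hl
    have : p' = p := by
      apply Subtype.ext
      funext i
      by_cases hi : N ≤ i
      · exact hz i hi
      · have h0 := (Finset.sum_eq_zero_iff.mp (Nat.le_zero.mp hl)) i (by simpa using hi)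
        omega
    simp [this]
  | succ r ih =>
    intro p p' hle hl
    by_cases heq : p' = p
    · subst heq
      have h1 : 1 ≤ Real.exp ((r + 1 : ℕ) * ε) := Real.one_le_exp (by positivity)
      have h2 : 0 ≤ ((r + 1 : ℕ) : ℝ) * δ := by positivity
      nlinarith [hP0 p']
    · have hex : ∃ i, p.1 i < p'.1 i := by
        by_contra hc
        push Not at hc
        exact heq (Subtype.ext (funext fun i => le_antisymm (hc i) (hle i)))
      classical
      let i0 := Nat.find hex
      have hi0 : p.1 i0 < p'.1 i0 := Nat.find_spec hex
      have hmin : ∀ j, j < i0 → p.1 j = p'.1 j := fun j hj => by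
        have := Nat.find_min hex hj
        have := hle j
        omega
      obtain ⟨N, hN⟩ := p'.2.1.exists_bound
      let f : ℕ → ℕ := fun i => if i = i0 then p.1 i + 1 else p.1 i
      have hf1 : ∀ i, p.1 i ≤ f i := fun i => by simp only [f]; split_ifs <;> omega
      have hf2 : ∀ i, f i ≤ p'.1 i := fun i => by
        simp only [f]; split_ifs with h
        · subst h; exact hi0
        · exact hle i
      have hfN : ∀ i, N ≤ i → f i = 0 := fun i hi => by
        have := hN i hi; have := hf2 i; omega
      have hpN : ∀ i, N ≤ i → p.1 i = 0 := fun i hi => by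
        have := hN i hi; have := hle i; omega
      have hi0N : i0 < N := by
        by_contra hc
        have := hN i0 (not_lt.mp hc); omega
      have hanti : Antitone f := by
        intro a b hab
        have hpa := p.2.1.1 hab
        have hpa' := p'.2.1.1 hab
        simp only [f]
        split_ifs with h1 h2 h2
        · omega
        · have hlt : a < i0 := by omega
          have := hmin a hlt
          subst h1
          omega
        · omega
        · exact hpa
      have hfsize : psize f ≤ n := by
        refine le_trans ?_ p'.2.2
        rw [psize_eq_sum f N hfN, psize_eq_sum p'.1 N hN]
        exact Finset.sum_le_sum fun i _ => hf2 i
      let p'' : PartLE n := ⟨f, isPartition_of_bound hanti N hfN, hfsize⟩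
      have hfp : l1 f p.1 = 1 := by
        rw [l1_eq_sum f p.1 N fun i hi => by rw [hfN i hi, hpN i hi]]
        rw [Finset.sum_eq_single i0]
        · simp [f]
        · intro b _ hb; simp [f, hb]
        · intro h; simp at h; omega
      have hadd : l1 p'.1 p.1 = l1 p'.1 f + l1 f p.1 := by
        rw [l1_eq_sum f p.1 N fun i hi => by rw [hfN i hi, hpN i hi],
          l1_eq_sum p'.1 p.1 N fun i hi => by rw [hN i hi, hpN i hi],
          l1_eq_sum p'.1 f N fun i hi => by rw [hN i hi, hfN i hi], ← Finset.sum_add_distrib]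
        refine Finset.sum_congr rfl fun i _ => ?_
        have := hf1 i; have := hf2 i
        omega
      have h1 := ih p'' p' hf2 (by show l1 p'.1 f ≤ r; omega)
      have h2 := hP p'' p (by show l1 f p.1 ≤ 1; omega)
      have e1 : Real.exp ((r + 1 : ℕ) * ε) = Real.exp (r * ε) * Real.exp ε := by
        rw [← Real.exp_add]; congr 1; push_cast; ring
      rw [e1]
      have h3 : 1 ≤ Real.exp ε := Real.one_le_exp hε
      calc P p' ≤ Real.exp (r * ε) * (P p'' + r * δ) := h1
        _ ≤ Real.exp (r * ε) * (Real.exp ε * (P p + (r + 1 : ℕ) * δ)) := by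
          apply mul_le_mul_of_nonneg_left _ (Real.exp_pos _).le
          have : 0 ≤ ((r + 1 : ℕ) : ℝ) * δ := by positivity
          have h4 : ((r + 1 : ℕ) : ℝ) * δ = r * δ + δ := by push_cast; ring
          nlinarith
        _ = _ := by ring

lemma pmf_compl {α : Type*} (μ : PMF α) (S : Set α) :
    μ.toOuterMeasure S + μ.toOuterMeasure Sᶜ = 1 := by
  rw [PMF.toOuterMeasure_apply, PMF.toOuterMeasure_apply, ← ENNReal.tsum_add, ← μ.tsum_coe]
  refine tsum_congr fun a => ?_
  by_cases h : a ∈ S <;> simp [h]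

lemma pmf_markov {α : Type*} (μ : PMF α) (S : Set α) (L : α → ℕ) (r : ℕ)
    (h : ∀ a ∈ S, r ≤ 2 * L a) :
    (r : ℝ≥0∞) * μ.toOuterMeasure S ≤ 2 * ∑' a, μ a * (L a : ℝ≥0∞) := by
  rw [PMF.toOuterMeasure_apply, ← ENNReal.tsum_mul_left, ← ENNReal.tsum_mul_left]
  refine ENNReal.tsum_le_tsum fun a => ?_
  by_cases ha : a ∈ S
  · have : (r : ℝ≥0∞) ≤ 2 * (L a : ℝ≥0∞) := by exact_mod_cast h a ha
    simp only [ha, Set.indicator_of_mem]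
    calc (r : ℝ≥0∞) * μ a ≤ 2 * (L a : ℝ≥0∞) * μ a := by gcongr
      _ = _ := by ring
  · simp [ha]

/-- Two-point bound. -/
lemma two_point {n : ℕ} {ε δ : ℝ} (hε : 0 < ε) (hδ : 0 ≤ δ) (hδε : δ ≤ 0.1 * ε)
    (A : PartLE n → PMF IntPart)
    (hA : ∀ p p' : PartLE n, l1 p.1 p'.1 ≤ 1 → ∀ S : Set IntPart,
            (A p).toOuterMeasure S ≤
              ENNReal.ofReal (Real.exp ε) * (A p').toOuterMeasure S
                + ENNReal.ofReal δ)
    (r : ℕ) (hr : (r : ℝ) * ε ≤ 1 / 4) (p p' : PartLE n) (hle : ∀ i, p.1 i ≤ p'.1 i)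
    (hl : l1 p'.1 p.1 ≤ r) (L L' : IntPart → ℕ) (hL : ∀ q, r ≤ L q + L' q) :
    (r : ℝ≥0∞) ≤ 4 * (∑' q, A p q * (L q : ℝ≥0∞) + ∑' q, A p' q * (L' q : ℝ≥0∞)) := by
  let S : Set IntPart := {q | r ≤ 2 * L q}
  have hfin : ∀ (p : PartLE n) (S : Set IntPart), (A p).toOuterMeasure S ≠ ⊤ := fun p S =>
    ne_top_of_le_ne_top ENNReal.one_ne_top (by rw [← pmf_compl (A p) S]; exact le_self_add)
  have hg := group_privacy hε.le hδ (fun p => ((A p).toOuterMeasure S).toReal)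
    (fun _ => ENNReal.toReal_nonneg) (fun a b hab => by
      have h := ENNReal.toReal_mono (by
        exact ENNReal.add_ne_top.mpr ⟨ENNReal.mul_ne_top ENNReal.ofReal_ne_top (hfin _ _),
          ENNReal.ofReal_ne_top⟩) (hA a b hab S)
      rw [ENNReal.toReal_add (ENNReal.mul_ne_top ENNReal.ofReal_ne_top (hfin _ _))
        ENNReal.ofReal_ne_top, ENNReal.toReal_mul, ENNReal.toReal_ofReal (Real.exp_pos _).le,
        ENNReal.toReal_ofReal hδ] at h
      exact h) r p p' hle hl
  have m1 := pmf_markov (A p) S L r fun a ha => ha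
  have m2 := pmf_markov (A p') Sᶜ L' r fun a ha => by
    have h1 : ¬ (r ≤ 2 * L a) := ha
    have := hL a
    omega
  have hc := pmf_compl (A p') S
  have hc' := congrArg ENNReal.toReal hc
  rw [ENNReal.toReal_add (hfin _ _) (hfin _ _)] at hc'
  simp only [ENNReal.toReal_one] at hc'
  have hexp : Real.exp (r * ε) ≤ 1.5 := by
    have h1 : Real.exp (r * ε) * (1 - r * ε) ≤ 1 := by
      have := Real.one_sub_le_exp_neg (r * ε)
      calc Real.exp (r * ε) * (1 - r * ε) ≤ Real.exp (r * ε) * Real.exp (-(r * ε)) := by gcongr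
        _ = 1 := by rw [← Real.exp_add]; simp
    nlinarith [Real.exp_pos (r * ε)]
  have hrd : (r : ℝ) * δ ≤ 0.025 := by
    have : (r : ℝ) * δ ≤ r * (0.1 * ε) := by gcongr
    nlinarith
  have key : (1 : ℝ≥0∞) ≤ 2 * ((A p).toOuterMeasure S + (A p').toOuterMeasure Sᶜ) := by
    rw [← ENNReal.toReal_le_toReal ENNReal.one_ne_top (ENNReal.mul_ne_top (by simp)
      (ENNReal.add_ne_top.mpr ⟨hfin _ _, hfin _ _⟩)), ENNReal.toReal_mul,
      ENNReal.toReal_add (hfin _ _) (hfin _ _)]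
    simp only [ENNReal.toReal_one, ENNReal.toReal_ofNat]
    have x0 : 0 ≤ ((A p).toOuterMeasure S).toReal := ENNReal.toReal_nonneg
    have y0 : 0 ≤ ((A p').toOuterMeasure Sᶜ).toReal := ENNReal.toReal_nonneg
    have rd0 : 0 ≤ (r : ℝ) * δ := by positivity
    nlinarith [Real.exp_pos (r * ε)]
  calc (r : ℝ≥0∞) = r * 1 := by ring
    _ ≤ r * (2 * ((A p).toOuterMeasure S + (A p').toOuterMeasure Sᶜ)) := by gcongr
    _ = 2 * (r * (A p).toOuterMeasure S + r * (A p').toOuterMeasure Sᶜ) := by ring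
    _ ≤ 2 * (2 * ∑' q, A p q * (L q : ℝ≥0∞) + 2 * ∑' q, A p' q * (L' q : ℝ≥0∞)) := by gcongr
    _ = _ := by ring

/-- Left end points of the blocks. -/
def xpos (k t : ℕ) : ℕ := ∑ s ∈ Finset.range t, 2 ^ (s / k)

lemma xpos_succ (k t : ℕ) : xpos k (t + 1) = xpos k t + 2 ^ (t / k) :=
  Finset.sum_range_succ _ _

lemma xpos_mono (k : ℕ) : Monotone (xpos k) :=
  monotone_nat_of_le_succ fun t => by rw [xpos_succ]; exact Nat.le_add_right _ _

lemma xpos_le (k : ℕ) (hk : 0 < k) (t : ℕ) :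
    xpos k (t + 1) ≤ 2 ^ (t / k) * (k + t % k + 1) := by
  induction t with
  | zero => simp [xpos]
  | succ t ih =>
    rw [xpos_succ]
    by_cases h : t % k + 1 = k
    · have hd : (t + 1) / k = t / k + 1 := by
        rw [Nat.succ_div_of_dvd]
        refine ⟨t / k + 1, ?_⟩
        have h2 := Nat.div_add_mod t k
        rw [mul_add, mul_one]
        omega
      have hm : (t + 1) % k = 0 := by
        have h1 := Nat.div_add_mod (t + 1) k
        have h2 := Nat.div_add_mod t k
        rw [hd] at h1
        nlinarith
      rw [hd, hm, pow_succ]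
      nlinarith
    · have hlt : t % k + 1 < k := by have := Nat.mod_lt t hk; omega
      have h2 := Nat.div_add_mod t k
      have e : t + 1 = (t % k + 1) + k * (t / k) := by omega
      have hd : (t + 1) / k = t / k := by
        rw [e, Nat.add_mul_div_left _ _ hk, Nat.div_eq_of_lt hlt]
        simp
      have hm : (t + 1) % k = t % k + 1 := by
        rw [e, Nat.add_mul_mod_self_left, Nat.mod_eq_of_lt hlt]
      rw [hd, hm]
      nlinarith

/-- The hard partitions. -/
def hardP (J k : ℕ) (b : Fin (k * (J + 1)) → Bool) (i : ℕ) : ℕ :=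
  ∑ t : Fin (k * (J + 1)),
    if i < xpos k t + (if b t then 2 ^ ((t : ℕ) / k) else 0) then 2 ^ (J - (t : ℕ) / k) else 0

lemma hardP_antitone (J k : ℕ) (b) : Antitone (hardP J k b) := by
  intro i j hij
  refine Finset.sum_le_sum fun t _ => ?_
  by_cases h : j < xpos k t + (if b t then 2 ^ ((t : ℕ) / k) else 0)
  · rw [if_pos h, if_pos (by omega)]
  · rw [if_neg h]; exact Nat.zero_le _

lemma hardP_end_le (J k : ℕ) (b : Fin (k * (J + 1)) → Bool) (t : Fin (k * (J + 1))) :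
    xpos k t + (if b t then 2 ^ ((t : ℕ) / k) else 0) ≤ xpos k (t + 1) := by
  rw [xpos_succ]; split_ifs <;> simp

lemma hardP_zero (J k : ℕ) (b) (i : ℕ) (hi : xpos k (k * (J + 1)) ≤ i) : hardP J k b i = 0 := by
  refine Finset.sum_eq_zero fun t _ => ?_
  have h1 := hardP_end_le J k b t
  have h2 : xpos k (t + 1) ≤ xpos k (k * (J + 1)) := xpos_mono k t.2
  rw [if_neg (by omega)]

lemma hardP_size (J k : ℕ) (hk : 0 < k) (b) :
    psize (hardP J k b) ≤ k ^ 2 * (2 ^ (J + 1) * (J + 1)) := by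
  rw [psize_eq_sum _ _ (hardP_zero J k b)]
  unfold hardP
  rw [Finset.sum_comm]
  calc _ ≤ ∑ t : Fin (k * (J + 1)), k * 2 ^ (J + 1) := by
        refine Finset.sum_le_sum fun t _ => ?_
        rw [← Finset.sum_filter, Finset.sum_const, smul_eq_mul]
        have hc : (Finset.filter (fun i => i < xpos k t +
            (if b t then 2 ^ ((t : ℕ) / k) else 0)) (Finset.range (xpos k (k * (J + 1))))).card
            ≤ xpos k (t + 1) := by
          calc _ ≤ (Finset.range (xpos k (t + 1))).card := by
                apply Finset.card_le_card
                intro i hi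
                have := hardP_end_le J k b t
                simp only [Finset.mem_filter, Finset.mem_range] at hi ⊢
                omega
            _ = _ := Finset.card_range _
        have hx := xpos_le k hk t
        have hm := Nat.mod_lt (t : ℕ) hk
        have hJ : (t : ℕ) / k ≤ J := Nat.lt_succ_iff.mp (Nat.div_lt_of_lt_mul t.2)
        have hpow : 2 ^ ((t : ℕ) / k) * 2 ^ (J - (t : ℕ) / k) = 2 ^ J := by
          rw [← pow_add]; congr 1; omega
        calc _ ≤ (2 ^ ((t : ℕ) / k) * (k + t % k + 1)) * 2 ^ (J - (t : ℕ) / k) := by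
              gcongr; exact hc.trans hx
          _ = 2 ^ J * (k + t % k + 1) := by rw [← hpow]; ring
          _ ≤ 2 ^ J * (2 * k) := by gcongr; omega
          _ = _ := by ring
    _ = _ := by simp; ring

lemma hardP_flip (J k : ℕ) (b : Fin (k * (J + 1)) → Bool) (t) (hb : b t = false) (i : ℕ) :
    hardP J k (Function.update b t true) i = hardP J k b i +
      if i ∈ Finset.Ico (xpos k t) (xpos k (t + 1)) then 2 ^ (J - (t : ℕ) / k) else 0 := by
  unfold hardP
  rw [← Finset.add_sum_erase _ _ (Finset.mem_univ t),
    ← Finset.add_sum_erase (a := t) _ _ (Finset.mem_univ t)]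
  have : ∑ x ∈ Finset.univ.erase t, (if i < xpos k x + (if Function.update b t true x then 2 ^ ((x : ℕ) / k) else 0) then 2 ^ (J - (x : ℕ) / k) else 0)
     = ∑ x ∈ Finset.univ.erase t, (if i < xpos k x + (if b x then 2 ^ ((x : ℕ) / k) else 0) then 2 ^ (J - (x : ℕ) / k) else 0) := by
    refine Finset.sum_congr rfl fun x hx => ?_
    rw [Function.update_of_ne (Finset.ne_of_mem_erase hx)]
  rw [this]
  simp only [Function.update_self, hb, Finset.mem_Ico, xpos_succ]
  simp only [if_true, Bool.false_eq_true, if_false, add_zero]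
  have : 0 < 2 ^ ((t : ℕ) / k) := by positivity
  generalize 2 ^ ((t : ℕ) / k) = w at *
  split_ifs <;> omega

lemma sum_blocks (k M : ℕ) (f : ℕ → ℕ) :
    ∑ t : Fin M, ∑ i ∈ Finset.Ico (xpos k t) (xpos k (t + 1)), f i
      = ∑ i ∈ Finset.range (xpos k M), f i := by
  rw [Fin.sum_univ_eq_sum_range (fun t => ∑ i ∈ Finset.Ico (xpos k t) (xpos k (t + 1)), f i) M]
  induction M with
  | zero => simp [xpos]
  | succ M ih =>
    rw [Finset.sum_range_succ, ih, Finset.sum_range_add_sum_Ico _ (xpos_mono k (Nat.le_succ M))]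

/-- Block loss. -/
def blockLoss (k t : ℕ) (q p : ℕ → ℕ) : ℕ :=
  ∑ i ∈ Finset.Ico (xpos k t) (xpos k (t + 1)), ((q i : ℤ) - (p i : ℤ)).natAbs

lemma sum_blockLoss_le (k M : ℕ) (q p : ℕ → ℕ) (hq : IsPartition q) (hp : IsPartition p) :
    ∑ t : Fin M, blockLoss k t q p ≤ l1 q p := by
  unfold blockLoss
  rw [sum_blocks k M fun i => ((q i : ℤ) - (p i : ℤ)).natAbs]
  obtain ⟨N, hN⟩ := hq.exists_bound
  obtain ⟨N', hN'⟩ := hp.exists_bound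
  rw [l1_eq_sum q p (max (xpos k M) (max N N')) fun i hi => by
    rw [hN i (by omega), hN' i (by omega)]]
  exact Finset.sum_le_sum_of_subset (Finset.range_mono (le_max_left _ _))

/-- The core combinatorial bound. -/
lemma core {n : ℕ} {ε δ : ℝ} (hε : 0 < ε) (hδ : 0 ≤ δ) (hδε : δ ≤ 0.1 * ε)
    (A : PartLE n → PMF IntPart)
    (hA : ∀ p p' : PartLE n, l1 p.1 p'.1 ≤ 1 → ∀ S : Set IntPart,
            (A p).toOuterMeasure S ≤
              ENNReal.ofReal (Real.exp ε) * (A p').toOuterMeasure S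
                + ENNReal.ofReal δ)
    (J k : ℕ) (hk : 0 < k) (hJ : (2 : ℝ) ^ J * ε ≤ 1 / 4)
    (hn : k ^ 2 * (2 ^ (J + 1) * (J + 1)) ≤ n) :
    ∃ p : PartLE n, ((k * (J + 1) * 2 ^ J : ℕ) : ℝ≥0∞) ≤
      8 * ∑' q : IntPart, A p q * (l1 q.1 p.1 : ℝ≥0∞) := by
  let M := k * (J + 1)
  let pb : (Fin M → Bool) → PartLE n := fun b =>
    ⟨hardP J k b, isPartition_of_bound (hardP_antitone J k b) _ (hardP_zero J k b),
      (hardP_size J k hk b).trans hn⟩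
  let F : Fin M → (Fin M → Bool) → ℝ≥0∞ := fun t b =>
    ∑' q : IntPart, A (pb b) q * (blockLoss k t q.1 (pb b).1 : ℝ≥0∞)
  have hpair0 : ∀ t b, b t = false →
      ((2 ^ J : ℕ) : ℝ≥0∞) ≤ 4 * (F t b + F t (Function.update b t true)) := by
    intro t b hb
    have hfl := hardP_flip J k b t hb
    have hJt : (t : ℕ) / k ≤ J := Nat.lt_succ_iff.mp (Nat.div_lt_of_lt_mul t.2)
    have hpow : 2 ^ ((t : ℕ) / k) * 2 ^ (J - (t : ℕ) / k) = 2 ^ J := by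
      rw [← pow_add]; congr 1; omega
    have hsum : ∑ i ∈ Finset.Ico (xpos k t) (xpos k (t + 1)), 2 ^ (J - (t : ℕ) / k) = 2 ^ J := by
      rw [Finset.sum_const, Nat.card_Ico, xpos_succ, smul_eq_mul, Nat.add_sub_cancel_left, hpow]
    refine two_point hε hδ hδε A hA (2 ^ J) (by push_cast; exact hJ) (pb b)
      (pb (Function.update b t true)) (fun i => ?_) ?_ _ _ (fun q => ?_)
    · show hardP J k b i ≤ hardP J k (Function.update b t true) i
      rw [hfl]; omega
    · show l1 (hardP J k (Function.update b t true)) (hardP J k b) ≤ 2 ^ J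
      rw [l1_eq_sum _ _ (xpos k M) fun i hi => by rw [hardP_zero _ _ _ i hi, hardP_zero _ _ _ i hi]]
      rw [← hsum, ← Finset.sum_filter_add_sum_filter_not _ (fun i => i ∈ Finset.Ico (xpos k t) (xpos k (t + 1)))]
      have h0 : ∑ x ∈ Finset.range (xpos k M) with x ∉ Finset.Ico (xpos k t) (xpos k (t + 1)),
          ((hardP J k (Function.update b t true) x : ℤ) - (hardP J k b x : ℤ)).natAbs = 0 := by
        refine Finset.sum_eq_zero fun i hi => ?_
        rw [hfl, if_neg (Finset.mem_filter.mp hi).2]; simp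
      rw [h0, add_zero]
      calc _ = ∑ x ∈ Finset.range (xpos k M) with x ∈ Finset.Ico (xpos k t) (xpos k (t + 1)),
            2 ^ (J - (t : ℕ) / k) := by
            refine Finset.sum_congr rfl fun i hi => ?_
            rw [hfl, if_pos (Finset.mem_filter.mp hi).2]
            push_cast; simp [Int.natAbs_pow]
        _ ≤ _ := Finset.sum_le_sum_of_subset fun i hi => (Finset.mem_filter.mp hi).2
    · show 2 ^ J ≤ blockLoss k t q.1 (hardP J k b) +
        blockLoss k t q.1 (hardP J k (Function.update b t true))
      unfold blockLoss
      rw [← hsum, ← Finset.sum_add_distrib]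
      refine Finset.sum_le_sum fun i hi => ?_
      have := hfl i
      rw [if_pos hi] at this
      omega
  let fl : Fin M → (Fin M → Bool) → (Fin M → Bool) := fun t b => Function.update b t (!b t)
  have hinv : ∀ t, Function.Involutive (fl t) := by
    intro t b
    simp [fl]
  have hpair : ∀ t b, ((2 ^ J : ℕ) : ℝ≥0∞) ≤ 4 * (F t b + F t (fl t b)) := by
    intro t b
    cases hb : b t
    · have := hpair0 t b hb
      simpa [fl, hb] using this
    · have := hpair0 t (fl t b) (by simp [fl, hb])
      have e : Function.update (fl t b) t true = b := by
        simp [fl, ← hb]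
      rw [e, add_comm] at this
      exact this
  have hsumt : ∀ t, ∑ b : Fin M → Bool, ((2 ^ J : ℕ) : ℝ≥0∞) ≤ 8 * ∑ b, F t b := by
    intro t
    calc _ ≤ ∑ b, 4 * (F t b + F t (fl t b)) := Finset.sum_le_sum fun b _ => hpair t b
      _ = 4 * (∑ b, F t b + ∑ b, F t (fl t b)) := by
        rw [← Finset.mul_sum, Finset.sum_add_distrib]
      _ = 4 * (∑ b, F t b + ∑ b, F t b) := by
        congr 2
        exact Equiv.sum_comp (hinv t).toPerm (F t)
      _ = _ := by ring
  let E : (Fin M → Bool) → ℝ≥0∞ := fun b =>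
    ∑' q : IntPart, A (pb b) q * (l1 q.1 (pb b).1 : ℝ≥0∞)
  have hE : ∀ b, ∑ t, F t b ≤ E b := by
    intro b
    simp only [F, E]
    rw [← Summable.tsum_finsetSum fun _ _ => ENNReal.summable]
    refine ENNReal.tsum_le_tsum fun q => ?_
    rw [← Finset.mul_sum]
    gcongr
    exact_mod_cast sum_blockLoss_le k M q.1 (pb b).1 q.2 (pb b).2.1
  have htot : ∑ b : Fin M → Bool, ((k * (J + 1) * 2 ^ J : ℕ) : ℝ≥0∞) ≤ ∑ b, 8 * E b := by
    calc _ = ∑ t : Fin M, ∑ b : Fin M → Bool, ((2 ^ J : ℕ) : ℝ≥0∞) := by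
          rw [Finset.sum_comm]
          refine Finset.sum_congr rfl fun b _ => ?_
          simp only [Finset.sum_const, Finset.card_univ, Fintype.card_fin, nsmul_eq_mul, M]
          push_cast; ring
      _ ≤ ∑ t, 8 * ∑ b, F t b := Finset.sum_le_sum fun t _ => hsumt t
      _ = ∑ b, 8 * ∑ t, F t b := by
        rw [← Finset.mul_sum, Finset.sum_comm, Finset.mul_sum]
      _ ≤ _ := Finset.sum_le_sum fun b _ => by gcongr; exact hE b
  by_contra hcon
  push Not at hcon
  exact absurd htot (not_le.mpr
    (ENNReal.sum_lt_sum_of_nonempty Finset.univ_nonempty fun b _ => hcon (pb b)))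

/-- High-privacy lower bound: there is an absolute constant `c > 0` such that for all
`n ≥ 2` and all `ε, δ` with `(log₂ n)/n < ε < 10⁻⁶` and `0 < δ < 0.1·ε`, every
`(ε,δ)`-DP algorithm `A : I_{≤n} → PMF(I)` has, on some input `p ∈ I_{≤n}`, expected
ℓ1-error at least `c·√((n/ε)·log₂(1/ε))`. -/
theorem high_privacy_lower_bound :
    ∃ c : ℝ, 0 < c ∧
      ∀ n : ℕ, 2 ≤ n → ∀ ε δ : ℝ,
        Real.logb 2 n / n < ε → ε < 1e-6 → 0 < δ → δ < 0.1 * ε →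
        ∀ A : PartLE n → PMF IntPart,
          (∀ p p' : PartLE n, l1 p.1 p'.1 ≤ 1 → ∀ S : Set IntPart,
            (A p).toOuterMeasure S ≤
              ENNReal.ofReal (Real.exp ε) * (A p').toOuterMeasure S
                + ENNReal.ofReal δ) →
          ∃ p : PartLE n,
            ENNReal.ofReal (c * Real.sqrt ((n / ε) * Real.logb 2 (1 / ε))) ≤
              ∑' q : IntPart, A p q * (l1 q.1 p.1 : ℝ≥0∞) := by
  refine ⟨1 / 100, by norm_num, ?_⟩
  intro n hn ε δ hlog hε1 hδ0 hδ A hA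
  have hn0 : (0 : ℝ) < n := by exact_mod_cast (by omega : 0 < n)
  have hn2 : (2 : ℝ) ≤ n := by exact_mod_cast hn
  have hlogn : 1 ≤ Real.logb 2 n := by
    rw [Real.le_logb_iff_rpow_le (by norm_num) hn0]; simpa using hn2
  have hε : 0 < ε := lt_trans (by positivity) hlog
  rw [div_lt_iff₀ hn0] at hlog
  have hinvn : 1 / ε ≤ n := by
    rw [div_le_iff₀ hε]; nlinarith
  set ℓ := Real.logb 2 (1 / ε) with hℓ
  have hℓn : ℓ ≤ Real.logb 2 n :=
    Real.logb_le_logb_of_le (by norm_num) (by positivity) hinvn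
  have hinv : (10 : ℝ) ^ 6 < 1 / ε := by
    rw [lt_div_iff₀ hε]; norm_num at hε1 ⊢; linarith
  have hℓ4 : 4 ≤ ℓ := by
    rw [hℓ, Real.le_logb_iff_rpow_le (by norm_num) (by positivity)]
    norm_num at hinv ⊢; linarith
  obtain ⟨J, hJ1, hJ2⟩ := exists_nat_pow_near (x := 1 / ε / 4) (y := (2 : ℝ))
    (by norm_num at hinv ⊢; linarith) (by norm_num)
  have hlq : Real.logb 2 (1 / ε / 4) = ℓ - 2 := by
    rw [Real.logb_div (by positivity) (by norm_num), hℓ]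
    congr 1
    rw [show (4 : ℝ) = 2 ^ (2 : ℝ) by norm_num, Real.logb_rpow (by norm_num) (by norm_num)]
  have hJu : (J : ℝ) ≤ ℓ - 2 := by
    rw [← hlq, Real.le_logb_iff_rpow_le (by norm_num) (by positivity)]
    simpa using hJ1
  have hJl : ℓ - 2 < (J : ℝ) + 1 := by
    rw [← hlq, Real.logb_lt_iff_lt_rpow (by norm_num) (by positivity)]
    exact_mod_cast hJ2
  have hεi : 1 / ε * ε = 1 := by field_simp
  have hJε : (2 : ℝ) ^ J * ε ≤ 1 / 4 := by nlinarith
  set N := 2 ^ (J + 1) * (J + 1) with hN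
  have hNpos : 0 < N := by positivity
  have hNR : (N : ℝ) = 2 * 2 ^ J * (J + 1) := by rw [hN]; push_cast; ring
  have hNn : N ≤ n := by
    have : (N : ℝ) ≤ n := by
      rw [hNR]
      have h1 : (J : ℝ) + 1 ≤ n * ε := by nlinarith
      calc 2 * 2 ^ J * ((J : ℝ) + 1) ≤ 2 * 2 ^ J * (n * ε) := by gcongr
        _ = 2 * n * (2 ^ J * ε) := by ring
        _ ≤ 2 * n * (1 / 4) := by gcongr
        _ ≤ n := by linarith
    exact_mod_cast this
  set k := Nat.sqrt (n / N) with hk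
  have hdiv : 1 ≤ n / N := (Nat.one_le_div_iff hNpos).mpr hNn
  have hk0 : 0 < k := Nat.sqrt_pos.mpr hdiv
  have hk1 : k ^ 2 * N ≤ n :=
    (Nat.mul_le_mul_right N (Nat.sqrt_le' (n / N))).trans (Nat.div_mul_le_self n N)
  have hk2 : n < (k + 1) ^ 2 * N := by
    rw [← Nat.div_lt_iff_lt_mul hNpos]
    exact Nat.lt_succ_sqrt' (n / N)
  obtain ⟨p, hp⟩ := core hε hδ0.le hδ.le A hA J k hk0 hJε hk1
  refine ⟨p, ?_⟩
  set E := ∑' q : IntPart, A p q * (l1 q.1 p.1 : ℝ≥0∞)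
  have hreal : 8 * (1 / 100 * Real.sqrt (n / ε * ℓ)) ≤ ((k * (J + 1) * 2 ^ J : ℕ) : ℝ) := by
    have hs : Real.sqrt (n / ε * ℓ) ≤ 12.5 * ((k * (J + 1) * 2 ^ J : ℕ) : ℝ) := by
      apply Real.sqrt_le_iff.mpr
      refine ⟨by positivity, ?_⟩
      push_cast
      have hk2R : (n : ℝ) ≤ ((k : ℝ) + 1) ^ 2 * (2 * 2 ^ J * (J + 1)) := by
        rw [← hNR]; exact_mod_cast hk2.le
      have hkR : (1 : ℝ) ≤ k := by exact_mod_cast hk0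
      have h4 : (n : ℝ) ≤ (4 * (k : ℝ) ^ 2) * (2 * 2 ^ J * (J + 1)) := by
        refine hk2R.trans ?_
        gcongr
        nlinarith
      have h5 : 1 / ε ≤ 8 * 2 ^ J := by rw [pow_succ] at hJ2; linarith
      have h6 : ℓ ≤ 2 * ((J : ℝ) + 1) := by linarith
      calc (n : ℝ) / ε * ℓ = n * (1 / ε) * ℓ := by ring
        _ ≤ ((4 * (k : ℝ) ^ 2) * (2 * 2 ^ J * (J + 1))) * (8 * 2 ^ J) * (2 * ((J : ℝ) + 1)) := by
          gcongr
        _ = 128 * ((k : ℝ) * (J + 1) * 2 ^ J) ^ 2 := by ring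
        _ ≤ (12.5 * ((k : ℝ) * (J + 1) * 2 ^ J)) ^ 2 := by
          nlinarith [sq_nonneg ((k : ℝ) * (J + 1) * 2 ^ J)]
    linarith
  have h8 : 8 * ENNReal.ofReal (1 / 100 * Real.sqrt (n / ε * ℓ)) ≤ 8 * E := by
    refine le_trans ?_ hp
    rw [← ENNReal.ofReal_natCast (k * (J + 1) * 2 ^ J),
      show (8 : ℝ≥0∞) = ENNReal.ofReal 8 by simp, ← ENNReal.ofReal_mul (by norm_num)]
    exact ENNReal.ofReal_le_ofReal hreal
  exact (ENNReal.mul_le_mul_iff_right (by norm_num) (by norm_num)).mp h8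
end

section
/- There is an absolute constant c > 0 with the following property. For all n, Δ ∈ ℕ with n ≥ Δ and Δ > 10·√n, there exist a natural number T with T ≥ exp(c·(n/Δ)·log₂(Δ/√n)) and integer partitions p₁, …, p_T ∈ I_{≤n} such that for all i ≠ j, 0.01·Δ ≤ ‖p_i − p_j‖₁ ≤ Δ. -/
/-- Weighted count of the Boolean cube around a point. -/
lemma cube_weight {ι : Type*} [Fintype ι] [DecidableEq ι] (x : ι → Bool) (z : ℝ) :
    ∑ y : ι → Bool, z ^ (hammingDist x y) = (1 + z) ^ (Fintype.card ι) := by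
  have h1 : ∀ y : ι → Bool, z ^ (hammingDist x y) = ∏ i, (if x i ≠ y i then z else 1) := by
    intro y
    rw [Finset.prod_ite]
    simp [hammingDist]
  simp_rw [h1]
  have h2 := (Finset.prod_univ_sum (fun _ : ι => (Finset.univ : Finset Bool))
    (fun i b => if x i ≠ b then z else (1:ℝ)))
  rw [Fintype.piFinset_univ] at h2
  rw [← h2]
  have h3 : ∀ i, ∑ b : Bool, (if x i ≠ b then z else (1:ℝ)) = 1 + z := by
    intro i
    cases x i <;> simp [add_comm]
  rw [Finset.prod_congr rfl (fun i _ => h3 i)]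
  simp

/-- A Gilbert-Varshamov code. -/
lemma gv_code (ι : Type*) [Fintype ι] [DecidableEq ι] :
    ∃ C : Finset (ι → Bool),
      (∀ x ∈ C, ∀ y ∈ C, x ≠ y → Fintype.card ι ≤ 8 * hammingDist x y) ∧
      ((4:ℝ) / 3) ^ (Fintype.card ι) ≤ C.card := by
  classical
  set N := Fintype.card ι with hN
  let F : Finset (Finset (ι → Bool)) := Finset.univ.filter
    (fun C => ∀ x ∈ C, ∀ y ∈ C, x ≠ y → N ≤ 8 * hammingDist x y)
  obtain ⟨C, hCF, hmax⟩ := F.exists_max_image Finset.card ⟨∅, by simp [F]⟩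
  have hC : ∀ x ∈ C, ∀ y ∈ C, x ≠ y → N ≤ 8 * hammingDist x y := by
    simpa [F] using hCF
  refine ⟨C, hC, ?_⟩
  have hcov : ∀ y : ι → Bool, ∃ x ∈ C, 8 * hammingDist x y ≤ N := by
    intro y
    by_contra! hno
    have hy : y ∉ C := by
      intro hy
      have := hno y hy
      simp at this
    have hins : insert y C ∈ F := by
      simp only [F, Finset.mem_filter, Finset.mem_univ, true_and]
      intro a ha b hb hab
      rw [Finset.mem_insert] at ha hb
      rcases ha with rfl | ha <;> rcases hb with rfl | hb
      · exact absurd rfl hab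
      · rw [hammingDist_comm]; exact (hno b hb).le
      · exact (hno a ha).le
      · exact hC a ha b hb hab
    have := hmax _ hins
    rw [Finset.card_insert_of_notMem hy] at this
    omega
  set z : ℝ := (5/6)^8 with hz
  have hz0 : 0 ≤ z := by positivity
  have hpt : ∀ y : ι → Bool, ((5:ℝ)/6)^N ≤ ∑ x ∈ C, z ^ (hammingDist x y) := by
    intro y
    obtain ⟨x, hx, hd⟩ := hcov y
    calc ((5:ℝ)/6)^N ≤ (5/6)^(8 * hammingDist x y) :=
          pow_le_pow_of_le_one (by norm_num) (by norm_num) hd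
      _ = z ^ (hammingDist x y) := by rw [hz, pow_mul]
      _ ≤ _ := Finset.single_le_sum (f := fun x => z ^ (hammingDist x y))
          (fun i _ => pow_nonneg hz0 _) hx
  have hsum : (2:ℝ)^N * (5/6)^N ≤ C.card * (1+z)^N := by
    have h := Finset.sum_le_sum (fun y (_ : y ∈ (Finset.univ : Finset (ι → Bool))) => hpt y)
    rw [Finset.sum_comm] at h
    simp_rw [cube_weight] at h
    simpa [hN] using h
  have hz1 : 1 + z ≤ 5/4 := by rw [hz]; norm_num
  have h5 : (4/3:ℝ)^N * (5/4)^N ≤ C.card * (5/4)^N := by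
    calc (4/3:ℝ)^N * (5/4)^N = (2:ℝ)^N * (5/6)^N := by
          rw [← mul_pow, ← mul_pow]; norm_num
      _ ≤ C.card * (1+z)^N := hsum
      _ ≤ _ := by gcongr
  exact le_of_mul_le_mul_right h5 (by positivity)

/-- The staircase partition attached to a word. -/
def stair (S m v : ℕ) (b : Fin S × Fin m → Bool) (i : ℕ) : ℕ :=
  ∑ j : Fin S × Fin m,
    if i < (m + j.2 + (b j).toNat) * 2 ^ (j.1 : ℕ) then v * 2 ^ (S - (j.1 : ℕ)) else 0

lemma stair_end (S m : ℕ) (b : Fin S × Fin m → Bool) (j : Fin S × Fin m) :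
    (m + j.2 + (b j).toNat) * 2 ^ (j.1 : ℕ) ≤ 2 * m * 2 ^ S := by
  have h1 : m + j.2 + (b j).toNat ≤ 2 * m := by
    have := Bool.toNat_le (b j)
    have := j.2.2
    omega
  exact Nat.mul_le_mul h1 (Nat.pow_le_pow_right (by norm_num) j.1.2.le)

lemma stair_zero (S m v : ℕ) (b : Fin S × Fin m → Bool) (i : ℕ) (hi : 2 * m * 2 ^ S ≤ i) :
    stair S m v b i = 0 := by
  unfold stair
  refine Finset.sum_eq_zero fun j _ => if_neg ?_
  have := stair_end S m b j
  omega

lemma stair_isPartition (S m v : ℕ) (b : Fin S × Fin m → Bool) :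
    IsPartition (stair S m v b) := by
  constructor
  · intro i i' h
    unfold stair
    refine Finset.sum_le_sum fun j _ => ?_
    split_ifs <;> omega
  · refine (Finset.range (2 * m * 2 ^ S)).finite_toSet.subset ?_
    intro i hi
    by_contra hn
    exact hi (stair_zero S m v b i (by simpa using hn))

lemma stair_psize (S m v : ℕ) (b : Fin S × Fin m → Bool) :
    psize (stair S m v b) ≤ 2 * m * (m * (S * (v * 2 ^ S))) := by
  unfold psize
  rw [finsum_eq_sum_of_support_subset (s := Finset.range (2 * m * 2 ^ S))]
  · unfold stair
    rw [Finset.sum_comm]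
    have : ∀ j : Fin S × Fin m, ∑ i ∈ Finset.range (2 * m * 2 ^ S),
        (if i < (m + j.2 + (b j).toNat) * 2 ^ (j.1 : ℕ) then v * 2 ^ (S - (j.1 : ℕ)) else 0)
        ≤ 2 * m * (v * 2 ^ S) := by
      intro j
      rw [← Finset.sum_filter, Finset.sum_const, smul_eq_mul]
      have h1 : (Finset.filter (fun i => i < (m + j.2 + (b j).toNat) * 2 ^ (j.1 : ℕ))
          (Finset.range (2 * m * 2 ^ S))).card ≤ 2 * m * 2 ^ (j.1 : ℕ) := by
        calc _ ≤ (Finset.range ((m + j.2 + (b j).toNat) * 2 ^ (j.1 : ℕ))).card := by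
              apply Finset.card_le_card
              intro i hi
              simp only [Finset.mem_filter] at hi
              simpa using hi.2
          _ ≤ _ := by
              rw [Finset.card_range]
              apply Nat.mul_le_mul_right
              have := Bool.toNat_le (b j)
              have := j.2.2
              omega
      calc _ ≤ 2 * m * 2 ^ (j.1 : ℕ) * (v * 2 ^ (S - (j.1 : ℕ))) := Nat.mul_le_mul_right _ h1
        _ = 2 * m * (v * (2 ^ (j.1 : ℕ) * 2 ^ (S - (j.1 : ℕ)))) := by ring
        _ = _ := by rw [← pow_add, Nat.add_sub_cancel' j.1.2.le]
    refine (Finset.sum_le_sum fun j _ => this j).trans ?_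
    simp only [Finset.sum_const, Finset.card_univ, Fintype.card_prod, Fintype.card_fin,
      smul_eq_mul]
    apply le_of_eq
    ring
  · intro i hi
    by_contra hn
    exact hi (stair_zero S m v b i (by simpa using hn))

/-- The contribution of one strip to the difference. -/
def sdiffTerm (S m v : ℕ) (b c : Fin S × Fin m → Bool) (i : ℕ) (j : Fin S × Fin m) : ℤ :=
  ((if i < (m + j.2 + (b j).toNat) * 2 ^ (j.1 : ℕ) then v * 2 ^ (S - (j.1 : ℕ)) else 0 : ℕ) : ℤ)
  - ((if i < (m + j.2 + (c j).toNat) * 2 ^ (j.1 : ℕ) then v * 2 ^ (S - (j.1 : ℕ)) else 0 : ℕ) : ℤ)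

lemma sdiffTerm_natAbs (S m v : ℕ) (b c : Fin S × Fin m → Bool) (i : ℕ) (j : Fin S × Fin m) :
    (sdiffTerm S m v b c i j).natAbs =
      if b j ≠ c j ∧ (m + j.2) * 2 ^ (j.1 : ℕ) ≤ i ∧ i < (m + j.2 + 1) * 2 ^ (j.1 : ℕ)
      then v * 2 ^ (S - (j.1 : ℕ)) else 0 := by
  unfold sdiffTerm
  have hle : (m + j.2) * 2 ^ (j.1 : ℕ) ≤ (m + j.2 + 1) * 2 ^ (j.1 : ℕ) :=
    Nat.mul_le_mul_right _ (by omega)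
  generalize v * 2 ^ (S - (j.1 : ℕ)) = h
  cases hb : b j <;> cases hc : c j <;> simp only [Bool.toNat_false, Bool.toNat_true, add_zero]
  · simp
  · by_cases h1 : i < (m + j.2) * 2 ^ (j.1 : ℕ) <;>
      by_cases h2 : i < (m + j.2 + 1) * 2 ^ (j.1 : ℕ) <;> simp [h1, h2] <;> omega
  · by_cases h1 : i < (m + j.2) * 2 ^ (j.1 : ℕ) <;>
      by_cases h2 : i < (m + j.2 + 1) * 2 ^ (j.1 : ℕ) <;> simp [h1, h2] <;> omega
  · simp

lemma seg_disj (S m i : ℕ) (j l : Fin S × Fin m)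
    (hj : (m + j.2) * 2 ^ (j.1 : ℕ) ≤ i ∧ i < (m + j.2 + 1) * 2 ^ (j.1 : ℕ))
    (hl : (m + l.2) * 2 ^ (l.1 : ℕ) ≤ i ∧ i < (m + l.2 + 1) * 2 ^ (l.1 : ℕ)) : j = l := by
  have key : ∀ j l : Fin S × Fin m,
      i < (m + j.2 + 1) * 2 ^ (j.1 : ℕ) → (m + l.2) * 2 ^ (l.1 : ℕ) ≤ i →
      ¬ (j.1 : ℕ) < l.1 := by
    intro j l h1 h2 h3
    have h4 : (m + j.2 + 1) * 2 ^ (j.1 : ℕ) ≤ (2 * m) * 2 ^ (j.1 : ℕ) :=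
      Nat.mul_le_mul_right _ (by have := j.2.2; omega)
    have h5 : m * 2 ^ ((j.1 : ℕ) + 1) ≤ (m + l.2) * 2 ^ (l.1 : ℕ) :=
      Nat.mul_le_mul (by omega) (Nat.pow_le_pow_right (by norm_num) h3)
    rw [pow_succ] at h5
    nlinarith
  have hk : (j.1 : ℕ) = l.1 := by
    have := key j l hj.2 hl.1
    have := key l j hl.2 hj.1
    omega
  rw [hk] at hj
  have hpos : 0 < 2 ^ (l.1 : ℕ) := by positivity
  have a1 := Nat.lt_of_mul_lt_mul_right (lt_of_le_of_lt hj.1 hl.2)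
  have a2 := Nat.lt_of_mul_lt_mul_right (lt_of_le_of_lt hl.1 hj.2)
  apply Prod.ext
  · exact Fin.ext hk
  · apply Fin.ext; omega

lemma stair_l1 (S m v : ℕ) (b c : Fin S × Fin m → Bool) :
    l1 (stair S m v b) (stair S m v c) = v * 2 ^ S * hammingDist b c := by
  have hpt : ∀ i, ((stair S m v b i : ℤ) - (stair S m v c i : ℤ)).natAbs =
      ∑ j, (sdiffTerm S m v b c i j).natAbs := by
    intro i
    have e : ((stair S m v b i : ℤ) - (stair S m v c i : ℤ)) = ∑ j, sdiffTerm S m v b c i j := by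
      unfold stair sdiffTerm
      rw [Finset.sum_sub_distrib]
      push_cast
      rfl
    rw [e]
    by_cases h : ∃ j, sdiffTerm S m v b c i j ≠ 0
    · obtain ⟨j, hj⟩ := h
      have hseg : ∀ l, sdiffTerm S m v b c i l ≠ 0 →
          (m + l.2) * 2 ^ (l.1 : ℕ) ≤ i ∧ i < (m + l.2 + 1) * 2 ^ (l.1 : ℕ) := by
        intro l hl
        have := sdiffTerm_natAbs S m v b c i l
        by_contra hn
        rw [if_neg (fun h => hn h.2)] at this
        exact hl (Int.natAbs_eq_zero.mp this)
      have huniq : ∀ l, l ≠ j → sdiffTerm S m v b c i l = 0 := by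
        intro l hlj
        by_contra hl
        exact hlj (seg_disj S m i l j (hseg l hl) (hseg j hj))
      rw [Fintype.sum_eq_single j huniq,
        Fintype.sum_eq_single j (fun l hl => by rw [huniq l hl]; rfl)]
    · push Not at h
      simp [h]
  unfold l1
  rw [finsum_eq_sum_of_support_subset (s := Finset.range (2 * m * 2 ^ S))]
  · simp_rw [hpt]
    rw [Finset.sum_comm]
    have hj : ∀ j : Fin S × Fin m, ∑ i ∈ Finset.range (2 * m * 2 ^ S),
        (sdiffTerm S m v b c i j).natAbs = if b j ≠ c j then v * 2 ^ S else 0 := by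
      intro j
      simp_rw [sdiffTerm_natAbs]
      by_cases hbc : b j ≠ c j
      · simp only [hbc, ne_eq, not_false_eq_true, true_and, if_true]
        rw [← Finset.sum_filter, Finset.sum_const, smul_eq_mul]
        have hend := stair_end S m (fun _ => true) j
        simp only [Bool.toNat_true] at hend
        have : (Finset.filter (fun i => (m + j.2) * 2 ^ (j.1 : ℕ) ≤ i ∧
            i < (m + j.2 + 1) * 2 ^ (j.1 : ℕ)) (Finset.range (2 * m * 2 ^ S))) =
            Finset.Ico ((m + j.2) * 2 ^ (j.1 : ℕ)) ((m + j.2 + 1) * 2 ^ (j.1 : ℕ)) := by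
          ext i
          simp only [Finset.mem_filter, Finset.mem_range, Finset.mem_Ico]
          omega
        rw [this, Nat.card_Ico, add_mul (m + (j.2 : ℕ)) 1, Nat.add_sub_cancel_left, one_mul,
          mul_left_comm, ← pow_add, Nat.add_sub_cancel' j.1.2.le]
      · simp [hbc]
    rw [Finset.sum_congr rfl (fun j _ => hj j), ← Finset.sum_filter, Finset.sum_const,
      smul_eq_mul, mul_comm]
    rfl
  · intro i hi
    by_contra hn
    apply hi
    have hn' : 2 * m * 2 ^ S ≤ i := by simpa using hn
    simp [stair_zero S m v _ i hn']

/-- Packing of integer partitions: there is an absolute constant `c > 0` such that for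
all `n ≥ Δ > 10√n` there are `T ≥ exp(c·(n/Δ)·log₂(Δ/√n))` integer partitions in
`I_{≤n}` that are pairwise at ℓ1-distance between `0.01·Δ` and `Δ`. -/
theorem packing_of_partitions :
    ∃ c : ℝ, 0 < c ∧
      ∀ n Δ : ℕ, Δ ≤ n → 10 * Real.sqrt n < (Δ : ℝ) →
        ∃ T : ℕ,
          Real.exp (c * ((n : ℝ) / (Δ : ℝ)) * Real.logb 2 ((Δ : ℝ) / Real.sqrt n)) ≤
            (T : ℝ) ∧
          ∃ P : Fin T → PartLE n,
            ∀ i j : Fin T, i ≠ j →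
              (0.01 : ℝ) * (Δ : ℝ) ≤ (l1 (P i).1 (P j).1 : ℝ) ∧
              (l1 (P i).1 (P j).1 : ℝ) ≤ (Δ : ℝ) := by
  have hl43 : 0 < Real.log (4/3) := Real.log_pos (by norm_num)
  refine ⟨Real.log (4/3) / 4, by positivity, ?_⟩
  intro n Δ hΔn hΔ
  have hΔ0 : (0:ℝ) < Δ := lt_of_le_of_lt (by positivity) hΔ
  have hΔ0' : 0 < Δ := by exact_mod_cast hΔ0
  have hn0 : (0:ℝ) < n := by exact_mod_cast lt_of_lt_of_le hΔ0' hΔn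
  have hs0 : 0 < Real.sqrt n := Real.sqrt_pos.mpr hn0
  set x : ℝ := (Δ:ℝ) / Real.sqrt n with hx
  have hx10 : 10 < x := by rw [hx, lt_div_iff₀ hs0]; exact hΔ
  set S : ℕ := Nat.log 2 ⌊x⌋₊ with hS
  have hfl : ⌊x⌋₊ ≠ 0 := by
    have : 10 ≤ ⌊x⌋₊ := Nat.le_floor (by push_cast; linarith)
    omega
  have hSx : (2:ℝ)^S ≤ x := by
    have h1 : 2^S ≤ ⌊x⌋₊ := Nat.pow_log_le_self 2 hfl
    have h2 : ((2^S : ℕ) : ℝ) ≤ x := (Nat.le_floor_iff (by linarith)).mp h1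
    exact_mod_cast h2
  have hxS : x < (2:ℝ)^(S+1) := by
    have h1 : ⌊x⌋₊ < 2^(S+1) := Nat.lt_pow_succ_log_self (by norm_num) _
    have h2 := (Nat.floor_lt (by linarith)).mp h1
    exact_mod_cast h2
  have hS1 : 1 ≤ S := by
    by_contra h
    have : S = 0 := by omega
    rw [this] at hxS
    norm_num at hxS
    linarith
  have hlog : Real.logb 2 x ≤ 2 * S := by
    have h1 : Real.logb 2 x < S + 1 := by
      rw [Real.logb_lt_iff_lt_rpow (by norm_num) (by linarith)]
      exact_mod_cast hxS
    have : (1:ℝ) ≤ S := by exact_mod_cast hS1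
    linarith
  have h2S : 2 * S ≤ 2 ^ S := by
    obtain ⟨k, hk⟩ : ∃ k, S = k + 1 := ⟨S - 1, by omega⟩
    rw [hk, pow_succ]
    have : k < 2 ^ k := Nat.lt_two_pow_self
    omega
  set m : ℕ := n / Δ with hm
  have hm1 : 1 ≤ m := (Nat.one_le_div_iff hΔ0').mpr hΔn
  have hmn : m * Δ ≤ n := Nat.div_mul_le_self n Δ
  have hnm : (n:ℝ) / Δ ≤ 2 * m := by
    rw [div_le_iff₀ hΔ0]
    have h1 : n < Δ * (m + 1) := Nat.lt_mul_div_succ n hΔ0'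
    have h2 : n ≤ 2 * m * Δ := by nlinarith
    exact_mod_cast h2
  have hxx : x ^ 2 * n = (Δ:ℝ)^2 := by
    rw [hx, div_pow, Real.sq_sqrt hn0.le]
    field_simp
  set D : ℕ := 2 * S * m * 2 ^ S with hD
  have hDΔ : D ≤ Δ := by
    have h1 : (2:ℝ)^S * 2^S ≤ x^2 := by
      rw [sq]; exact mul_le_mul hSx hSx (by positivity) (by linarith)
    have h2 : (2:ℝ)^S * 2^S * n ≤ (Δ:ℝ)^2 := by
      rw [← hxx]; exact mul_le_mul_of_nonneg_right h1 hn0.le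
    have h3 : 2^S * 2^S * n ≤ Δ^2 := by exact_mod_cast h2
    have h4 : 2^S * 2^S * m * Δ ≤ Δ * Δ := by
      calc 2^S * 2^S * m * Δ = 2^S * 2^S * (m * Δ) := by ring
        _ ≤ 2^S * 2^S * n := Nat.mul_le_mul_left _ hmn
        _ ≤ Δ * Δ := by rw [← sq Δ]; exact h3
    have h5 := Nat.le_of_mul_le_mul_right h4 hΔ0'
    calc D = (2 * S) * (m * 2^S) := by rw [hD]; ring
      _ ≤ 2^S * (m * 2^S) := Nat.mul_le_mul_right _ h2S
      _ = 2^S * 2^S * m := by ring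
      _ ≤ Δ := h5
  have hD0 : 0 < D := by rw [hD]; positivity
  set v : ℕ := Δ / D with hv
  have hv1 : 1 ≤ v := (Nat.one_le_div_iff hD0).mpr hDΔ
  have hvD : v * D ≤ Δ := Nat.div_mul_le_self Δ D
  have hDv : Δ ≤ 2 * (v * D) := by
    have h1 : Δ < D * (v + 1) := Nat.lt_mul_div_succ Δ hD0
    nlinarith
  obtain ⟨C, hC, hcard⟩ := gv_code (Fin S × Fin m)
  have hN : Fintype.card (Fin S × Fin m) = S * m := by simp
  rw [hN] at hC hcard
  refine ⟨C.card, ?_, ?_⟩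
  · refine le_trans ?_ hcard
    rw [← Real.exp_log (show (0:ℝ) < (4/3)^(S*m) by positivity), Real.log_pow]
    apply Real.exp_le_exp.mpr
    have hl0 : 0 ≤ Real.logb 2 x := Real.logb_nonneg (by norm_num) (by linarith)
    have h1 : (n:ℝ)/Δ * Real.logb 2 x ≤ (2 * m) * (2 * S) :=
      mul_le_mul hnm hlog hl0 (by positivity)
    push_cast
    nlinarith
  · let e := C.equivFin.symm
    have hsize : ∀ b : Fin S × Fin m → Bool, psize (stair S m v b) ≤ n := by
      intro b
      refine (stair_psize S m v b).trans ?_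
      calc 2 * m * (m * (S * (v * 2 ^ S))) = m * (v * D) := by rw [hD]; ring
        _ ≤ m * Δ := Nat.mul_le_mul_left _ hvD
        _ ≤ n := hmn
    refine ⟨fun i => ⟨stair S m v (e i).1, stair_isPartition S m v _, hsize _⟩, ?_⟩
    intro i j hij
    have hne : (e i).1 ≠ (e j).1 := by
      intro h
      exact hij (e.injective (Subtype.ext h))
    have hd := hC _ (e i).2 _ (e j).2 hne
    have hd2 : hammingDist (e i).1 (e j).1 ≤ S * m := by
      rw [← hN]; exact hammingDist_le_card_fintype
    simp only [stair_l1]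
    set d := hammingDist (e i).1 (e j).1
    have u1 : v * 2 ^ S * d ≤ Δ := by
      calc v * 2 ^ S * d ≤ v * 2^S * (S * m) := Nat.mul_le_mul_left _ hd2
        _ ≤ 2 * (v * 2^S * (S * m)) := by omega
        _ = v * D := by rw [hD]; ring
        _ ≤ Δ := hvD
    have u2 : Δ ≤ 32 * (v * 2 ^ S * d) := by
      calc Δ ≤ 2 * (v * D) := hDv
        _ = 4 * (v * 2^S * (S * m)) := by rw [hD]; ring
        _ ≤ 4 * (v * 2^S * (8 * d)) := by gcongr
        _ = _ := by ring
    constructor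
    · have : (Δ:ℝ) ≤ 32 * ((v * 2 ^ S * d : ℕ) : ℝ) := by exact_mod_cast u2
      linarith
    · exact_mod_cast u1
end

section
/- There are absolute constants C > 0 and c > 0 such that for every real ε ≥ 2 there exists a randomized algorithm A : I → PMF(I) which is ε-differentially private and such that for every integer partition p of size n = ∑_{i≥1} p_i, the expected ℓ1-error satisfies E_{q∼A(p)}[‖q − p‖₁] ≤ C·(√n·e^{−ε} + e^{−c·n}). -/
open scoped ENNReal

/-! ### Combinatorics: hook-line coordinates of a partition -/

/-- The conjugate partition: the number of parts exceeding `k`. -/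
noncomputable def conjP (p : ℕ → ℕ) (k : ℕ) : ℕ := sInf {i | p i ≤ k}

/-- Coordinates of a partition: the arms and legs of the diagonal hooks. -/
noncomputable def lineP (p : ℕ → ℕ) (k : ℕ) : ℤ × ℤ :=
  (((p k - k : ℕ) : ℤ), ((conjP p k - (k + 1) : ℕ) : ℤ))

/-- The l1 norm on `ℤ × ℤ`. -/
def nrm (z : ℤ × ℤ) : ℕ := z.1.natAbs + z.2.natAbs

/-- The l1 distance of sequences in `ℤ × ℤ`. -/
noncomputable def dline (x y : ℕ → ℤ × ℤ) : ℝ≥0∞ := ∑' k, (nrm (x k - y k) : ℝ≥0∞)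

lemma exists_le_of_partition {p : ℕ → ℕ} (hp : IsPartition p) : ∃ N, ∀ i, N ≤ i → p i = 0 := by
  obtain ⟨N, hN⟩ := hp.2.bddAbove
  refine ⟨N + 1, fun i hi => ?_⟩
  by_contra h
  have := hN (show i ∈ Function.support p from h)
  omega

lemma lt_conjP {p : ℕ → ℕ} (hp : IsPartition p) (i k : ℕ) : i < conjP p k ↔ k < p i := by
  constructor
  · intro h
    have := Nat.notMem_of_lt_sInf h
    simpa using this
  · intro h
    by_contra hc
    obtain ⟨N, hN⟩ := exists_le_of_partition hp
    have hne : ({i | p i ≤ k} : Set ℕ).Nonempty := ⟨N, by simp [hN N le_rfl]⟩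
    have h1 : p (conjP p k) ≤ k := Nat.sInf_mem hne
    have := hp.1 (not_lt.mp hc)
    omega

lemma conjP_anti {p : ℕ → ℕ} (hp : IsPartition p) : Antitone (conjP p) := by
  intro a b hab
  by_contra h
  have h1 := (lt_conjP hp (conjP p a) b).1 (not_le.mp h)
  have h2 := (lt_conjP hp (conjP p a) a).2 (by omega)
  omega

open Classical in
lemma tsum_line (k u v : ℕ) :
    (∑' j : ℕ, (if k ≤ j ∧ ¬ (j < u ↔ j < v) then (1 : ℝ≥0∞) else 0))
      = ((((u - k : ℕ) : ℤ) - ((v - k : ℕ) : ℤ)).natAbs : ℝ≥0∞) := by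
  rw [tsum_eq_sum (s := Finset.range (u + v))]
  · rw [Finset.sum_boole]
    congr 1
    have : Finset.filter (fun j => k ≤ j ∧ ¬ (j < u ↔ j < v)) (Finset.range (u + v))
        = Finset.Ico (max k (min u v)) (max u v) := by
      ext j
      simp only [Finset.mem_filter, Finset.mem_range, Finset.mem_Ico]
      omega
    rw [this, Nat.card_Ico]
    omega
  · intro j hj
    simp only [Finset.mem_range] at hj
    rw [if_neg]
    omega

lemma l1_eq_tsum {p q : ℕ → ℕ} (hp : IsPartition p) (hq : IsPartition q) :
    (l1 p q : ℝ≥0∞) = ∑' i, ((((p i : ℤ) - (q i : ℤ)).natAbs : ℕ) : ℝ≥0∞) := by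
  obtain ⟨N, hN⟩ := exists_le_of_partition hp
  obtain ⟨M, hM⟩ := exists_le_of_partition hq
  have h0 : ∀ i, i ∉ Finset.range (N + M) → ((p i : ℤ) - (q i : ℤ)).natAbs = 0 := by
    intro i hi
    simp only [Finset.mem_range] at hi
    rw [hN i (by omega), hM i (by omega)]
    rfl
  rw [tsum_eq_sum (s := Finset.range (N + M))]
  · unfold l1
    rw [finsum_eq_sum_of_support_subset (s := Finset.range (N + M))]
    · push_cast; rfl
    · intro i hi
      by_contra hc
      exact hi (h0 i (by simpa using hc))
  · intro i hi
    rw [h0 i hi]; simp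

open Classical in
lemma l1_eq_dline {p q : ℕ → ℕ} (hp : IsPartition p) (hq : IsPartition q) :
    (l1 p q : ℝ≥0∞) = dline (lineP p) (lineP q) := by
  rw [l1_eq_tsum hp hq]
  have e1 : ∀ i, ((((p i : ℤ) - (q i : ℤ)).natAbs : ℕ) : ℝ≥0∞)
      = (∑' j : ℕ, (if i ≤ j ∧ ¬ (j < p i ↔ j < q i) then (1 : ℝ≥0∞) else 0))
        + ∑' j : ℕ, (if j + 1 ≤ i ∧ ¬ (j < p i ↔ j < q i) then (1 : ℝ≥0∞) else 0) := by
    intro i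
    rw [← ENNReal.tsum_add]
    have := tsum_line 0 (p i) (q i)
    simp only [Nat.sub_zero] at this
    rw [← this]
    refine tsum_congr fun j => ?_
    rcases le_or_gt i j with h | h
    · have h' : ¬ (j + 1 ≤ i) := by omega
      simp [h, h']
    · have h' : ¬ (i ≤ j) := by omega
      have h'' : j + 1 ≤ i := h
      simp [h', h'']
  simp_rw [e1]
  rw [ENNReal.tsum_add, ENNReal.tsum_comm (f := fun i j => if j + 1 ≤ i ∧ ¬ (j < p i ↔ j < q i) then (1 : ℝ≥0∞) else 0),
    ← ENNReal.tsum_add]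
  unfold dline
  refine tsum_congr fun k => ?_
  rw [tsum_line]
  have : ∀ i, (if k + 1 ≤ i ∧ ¬ (k < p i ↔ k < q i) then (1 : ℝ≥0∞) else 0)
      = if k + 1 ≤ i ∧ ¬ (i < conjP p k ↔ i < conjP q k) then (1 : ℝ≥0∞) else 0 := by
    intro i
    simp only [lt_conjP hp, lt_conjP hq]
  simp_rw [this]
  rw [tsum_line]
  simp [nrm, lineP]

/-- The Durfee size. -/
lemma exists_durfee {p : ℕ → ℕ} (hp : IsPartition p) :
    ∃ d, d * d ≤ psize p ∧ ∀ k, d ≤ k → lineP p k = 0 := by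
  classical
  obtain ⟨N, hN⟩ := exists_le_of_partition hp
  have hex : ∃ k, p k ≤ k := ⟨N, by simp [hN N le_rfl]⟩
  refine ⟨Nat.find hex, ?_, ?_⟩
  · set d := Nat.find hex with hd
    have hge : ∀ i ∈ Finset.range d, d ≤ p i := by
      intro i hi
      simp only [Finset.mem_range] at hi
      have h1 := Nat.find_min hex (m := d - 1) (by omega)
      have h2 := hp.1 (show i ≤ d - 1 by omega)
      omega
    have hs : psize p = ∑ i ∈ Finset.range (N + d), p i := by
      unfold psize
      apply finsum_eq_sum_of_support_subset
      intro i hi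
      by_contra hc
      simp at hc
      exact hi (hN i (by omega))
    calc d * d = ∑ i ∈ Finset.range d, d := by simp
      _ ≤ ∑ i ∈ Finset.range d, p i := Finset.sum_le_sum hge
      _ ≤ ∑ i ∈ Finset.range (N + d), p i :=
          Finset.sum_le_sum_of_subset (Finset.range_mono (by omega))
      _ = psize p := hs.symm
  · intro k hk
    have h0 := Nat.find_spec hex
    have h1 : p k ≤ k := (hp.1 hk).trans (h0.trans hk)
    have h2 : ¬ (k + 1 < conjP p k) := by
      rw [lt_conjP hp]
      have := hp.1 (show k ≤ k + 1 by omega)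
      omega
    simp only [lineP, Prod.mk_eq_zero]
    omega

lemma tsum_tail {u : ℕ → ℕ} (T a : ℕ) (h : ∀ i, u (T + i) ≤ a - i) :
    (∑' k, if T ≤ k then (u k : ℝ≥0∞) else 0) ≤ (a : ℝ≥0∞) ^ 2 := by
  rw [tsum_eq_sum (s := Finset.Ico T (T + a))]
  · calc _ ≤ ∑ k ∈ Finset.Ico T (T + a), (a : ℝ≥0∞) := by
          refine Finset.sum_le_sum fun k hk => ?_
          simp only [Finset.mem_Ico] at hk
          rw [if_pos hk.1]
          have := h (k - T)
          rw [show T + (k - T) = k by omega] at this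
          exact_mod_cast (by omega : u k ≤ a)
      _ = _ := by simp [sq]
  · intro k hk
    simp only [Finset.mem_Ico] at hk
    split_ifs with hT
    · have := h (k - T)
      rw [show T + (k - T) = k by omega] at this
      exact_mod_cast (by omega : u k = 0)
    · rfl

/-- The quadratic potential. -/
def pot (z : ℤ × ℤ) : ℕ := z.1.natAbs ^ 2 + z.2.natAbs ^ 2

lemma nrm_le_pot (z : ℤ × ℤ) : nrm z ≤ pot z := by
  unfold nrm pot
  have h : ∀ a : ℕ, a ≤ a ^ 2 := fun a => by nlinarith [Nat.zero_le a, a.eq_zero_or_pos]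
  exact add_le_add (h _) (h _)

lemma tail_le_pot {p : ℕ → ℕ} (hp : IsPartition p) (T : ℕ) (z : ℤ × ℤ)
    (h1 : (lineP p T).1 + z.1 ≤ 0) (h2 : (lineP p T).2 + z.2 ≤ 0) :
    (∑' k, if T ≤ k then (nrm (lineP p k) : ℝ≥0∞) else 0) ≤ (pot z : ℝ≥0∞) := by
  have e : ∀ k, (if T ≤ k then (nrm (lineP p k) : ℝ≥0∞) else 0)
      = (if T ≤ k then ((p k - k : ℕ) : ℝ≥0∞) else 0)
        + (if T ≤ k then ((conjP p k - (k + 1) : ℕ) : ℝ≥0∞) else 0) := by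
    intro k
    split_ifs
    · simp [nrm, lineP]
    · simp
  simp_rw [e]
  rw [ENNReal.tsum_add]
  simp only [lineP] at h1 h2
  have a1 := tsum_tail (u := fun k => p k - k) T z.1.natAbs (fun i => by
    have := hp.1 (show T ≤ T + i by omega)
    omega)
  have a2 := tsum_tail (u := fun k => conjP p k - (k + 1)) T z.2.natAbs (fun i => by
    have := conjP_anti hp (show T ≤ T + i by omega)
    omega)
  unfold pot
  push_cast at a1 a2 ⊢
  exact add_le_add a1 a2

/-! ### The post-processing map -/

/-- Lines are read until both noisy coordinates are nonpositive. -/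
def haltAt (y : ℕ → ℤ × ℤ) (k : ℕ) : Prop := (y k).1 ≤ 0 ∧ (y k).2 ≤ 0

/-- The stopping predicate, made total. -/
def haltPred (k : ℕ) (y : ℕ → ℤ × ℤ) : Prop := haltAt y k ∨ ∀ j, ¬ haltAt y j

lemma exists_haltPred (y : ℕ → ℤ × ℤ) : ∃ k, haltPred k y := by
  by_cases h : ∃ k, haltAt y k
  · obtain ⟨k, hk⟩ := h
    exact ⟨k, Or.inl hk⟩
  · push Not at h
    exact ⟨0, Or.inr h⟩

/-- Truncation of a sequence. -/
def truncAt (T : ℕ) (y : ℕ → ℤ × ℤ) (k : ℕ) : ℤ × ℤ := if k < T then y k else 0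

lemma lineP_zero {p : ℕ → ℕ} (hp : IsPartition p) : ∃ N, ∀ k, N ≤ k → lineP p k = 0 :=
  let ⟨d, _, h⟩ := exists_durfee hp
  ⟨d, h⟩

lemma dline_nat {p : ℕ → ℕ} (hp : IsPartition p) (T : ℕ) (y : ℕ → ℤ × ℤ) :
    ∃ n : ℕ, dline (lineP p) (truncAt T y) = n := by
  obtain ⟨N, hN⟩ := lineP_zero hp
  refine ⟨∑ k ∈ Finset.range (N + T), nrm (lineP p k - truncAt T y k), ?_⟩
  unfold dline
  rw [tsum_eq_sum (s := Finset.range (N + T))]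
  · push_cast; rfl
  · intro k hk
    simp only [Finset.mem_range] at hk
    rw [hN k (by omega), truncAt, if_neg (by omega)]
    simp [nrm]

instance : Nonempty IntPart := ⟨⟨fun _ => 0, fun _ _ _ => le_rfl, by simp⟩⟩

lemma exists_best (T : ℕ) (y : ℕ → ℤ × ℤ) :
    ∃ q : IntPart, ∀ q' : IntPart,
      dline (lineP q.1) (truncAt T y) ≤ dline (lineP q'.1) (truncAt T y) := by
  choose f hf using fun q : IntPart => dline_nat q.2 T y
  refine ⟨Function.argmin f, fun q' => ?_⟩
  rw [hf, hf]
  have hle := Function.argmin_le f q'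
  exact_mod_cast hle

/-- Extend a finite sequence by zero. -/
def extZ (T : ℕ) (v : Fin T → ℤ × ℤ) (k : ℕ) : ℤ × ℤ := if h : k < T then v ⟨k, h⟩ else 0

/-- The closest partition to a finite noisy sequence. -/
noncomputable def bestFin (T : ℕ) (v : Fin T → ℤ × ℤ) : IntPart :=
  Classical.choose (exists_best T (extZ T v))

/-- The closest partition to the truncation at `T`. -/
noncomputable def bestAt (T : ℕ) (y : ℕ → ℤ × ℤ) : IntPart := bestFin T (fun i => y i)

lemma bestAt_le (T : ℕ) (y : ℕ → ℤ × ℤ) (q' : IntPart) :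
    dline (lineP (bestAt T y).1) (truncAt T y) ≤ dline (lineP q'.1) (truncAt T y) := by
  have h : dline (lineP (bestAt T y).1) (truncAt T (extZ T (fun i => y i)))
      ≤ dline (lineP q'.1) (truncAt T (extZ T (fun i => y i))) :=
    Classical.choose_spec (exists_best T (extZ T (fun i => y i))) q'
  have e : truncAt T (extZ T (fun i => y i)) = truncAt T y := by
    funext k
    unfold truncAt extZ
    split_ifs <;> rfl
  rw [e] at h
  exact h

open Classical in
/-- The post-processing. -/
noncomputable def post (y : ℕ → ℤ × ℤ) : IntPart := bestAt (Nat.find (exists_haltPred y)) y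

lemma nrm_sub_le (a b c : ℤ × ℤ) : nrm (a - c) ≤ nrm (a - b) + nrm (c - b) := by
  simp only [nrm, Prod.fst_sub, Prod.snd_sub]
  omega

lemma dline_triangle (a b c : ℕ → ℤ × ℤ) : dline a c ≤ dline a b + dline c b := by
  unfold dline
  rw [← ENNReal.tsum_add]
  refine ENNReal.tsum_le_tsum fun k => ?_
  exact_mod_cast nrm_sub_le _ _ _

/-- The pointwise error bound. -/
noncomputable def errB (d : ℕ) (w : ℕ → ℤ × ℤ) : ℝ≥0∞ :=
  2 * ∑ k ∈ Finset.range d, (pot (w k) : ℝ≥0∞)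
    + ∑' i, ∏ j ∈ Finset.Ico d (d + i + 1), (pot (w j) : ℝ≥0∞)

lemma one_le_pot_of_running {p : ℕ → ℕ} {w : ℕ → ℤ × ℤ} {k : ℕ} (h0 : lineP p k = 0)
    (h : ¬ haltAt (lineP p + w) k) : (1 : ℝ≥0∞) ≤ (pot (w k) : ℝ≥0∞) := by
  simp only [haltAt, Pi.add_apply, h0, zero_add] at h
  have : 1 ≤ pot (w k) := by
    refine le_trans ?_ (nrm_le_pot _)
    unfold nrm
    omega
  exact_mod_cast this

lemma dline_trunc_le {p : ℕ → ℕ} (hp : IsPartition p) (d : ℕ)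
    (hd : ∀ k, d ≤ k → lineP p k = 0) (w : ℕ → ℤ × ℤ) (T : ℕ)
    (hT : haltPred T (lineP p + w)) (hmin : ∀ k < T, ¬ haltPred k (lineP p + w)) :
    dline (lineP p) (truncAt T (lineP p + w)) ≤ errB d w := by
  by_cases hns : ∀ j, ¬ haltAt (lineP p + w) j
  · -- never stopping: the bound is infinite
    have : (∑' i, ∏ j ∈ Finset.Ico d (d + i + 1), (pot (w j) : ℝ≥0∞)) = ⊤ := by
      rw [eq_top_iff, ← ENNReal.tsum_const_eq_top_of_ne_zero (α := ℕ) (c := (1 : ℝ≥0∞)) one_ne_zero]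
      refine ENNReal.tsum_le_tsum fun i => ?_
      refine Finset.one_le_prod' fun j hj => ?_
      simp only [Finset.mem_Ico] at hj
      exact one_le_pot_of_running (hd j hj.1) (hns j)
    unfold errB
    rw [this]
    simp
  have hst : haltAt (lineP p + w) T := by
    rcases hT with h | h
    · exact h
    · exact absurd h hns
  have hmin' : ∀ k < T, ¬ haltAt (lineP p + w) k := fun k hk h => hmin k hk (Or.inl h)
  have split : dline (lineP p) (truncAt T (lineP p + w))
      = (∑ k ∈ Finset.range T, (nrm (w k) : ℝ≥0∞))
        + ∑' k, if T ≤ k then (nrm (lineP p k) : ℝ≥0∞) else 0 := by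
    unfold dline
    have e : ∀ k, (nrm (lineP p k - truncAt T (lineP p + w) k) : ℝ≥0∞)
        = (if k ∈ Finset.range T then (nrm (w k) : ℝ≥0∞) else 0)
          + (if T ≤ k then (nrm (lineP p k) : ℝ≥0∞) else 0) := by
      intro k
      unfold truncAt
      rcases lt_or_ge k T with h | h
      · have h' : ¬ T ≤ k := by omega
        simp [h, h', nrm]
      · have h' : ¬ k < T := by omega
        simp [h, h']
    simp_rw [e]
    rw [ENNReal.tsum_add]
    congr 1
    rw [tsum_eq_sum (s := Finset.range T)]
    · exact Finset.sum_congr rfl fun k hk => by rw [if_pos hk]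
    · intro k hk
      rw [if_neg hk]
  rw [split]
  have hnp : ∀ k, (nrm (w k) : ℝ≥0∞) ≤ (pot (w k) : ℝ≥0∞) := fun k => by
    exact_mod_cast nrm_le_pot (w k)
  rcases lt_or_ge T d with hTd | hTd
  · have h2 : (∑' k, if T ≤ k then (nrm (lineP p k) : ℝ≥0∞) else 0) ≤ (pot (w T) : ℝ≥0∞) :=
      tail_le_pot hp T (w T) hst.1 hst.2
    have h3 : (pot (w T) : ℝ≥0∞) ≤ ∑ k ∈ Finset.range d, (pot (w k) : ℝ≥0∞) :=
      Finset.single_le_sum (f := fun k => (pot (w k) : ℝ≥0∞)) (fun _ _ => zero_le) (by simpa using hTd)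
    have h1 : (∑ k ∈ Finset.range T, (nrm (w k) : ℝ≥0∞)) ≤ ∑ k ∈ Finset.range d, (pot (w k) : ℝ≥0∞) :=
      (Finset.sum_le_sum fun k _ => hnp k).trans
        (Finset.sum_le_sum_of_subset (Finset.range_mono hTd.le))
    unfold errB
    rw [two_mul]
    exact (add_le_add h1 (h2.trans h3)).trans le_self_add
  · have h0 : (∑' k, if T ≤ k then (nrm (lineP p k) : ℝ≥0∞) else 0) = 0 := by
      rw [ENNReal.tsum_eq_zero]
      intro k
      split_ifs with h
      · rw [hd k (hTd.trans h)]; simp [nrm]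
      · rfl
    rw [h0, add_zero]
    obtain ⟨e, rfl⟩ := Nat.exists_eq_add_of_le hTd
    rw [Finset.sum_range_add]
    unfold errB
    refine add_le_add ?_ ?_
    · refine (Finset.sum_le_sum fun k _ => hnp k).trans ?_
      rw [two_mul]
      exact le_self_add
    · refine le_trans ?_ (ENNReal.sum_le_tsum (Finset.range e))
      refine Finset.sum_le_sum fun i hi => ?_
      simp only [Finset.mem_range] at hi
      rw [Finset.prod_Ico_succ_top (by omega)]
      refine (hnp _).trans ?_
      refine le_mul_of_one_le_left' ?_
      refine Finset.one_le_prod' fun j hj => ?_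
      simp only [Finset.mem_Ico] at hj
      exact one_le_pot_of_running (hd j hj.1) (hmin' j (by omega))

lemma post_error (p : IntPart) (d : ℕ) (hd : ∀ k, d ≤ k → lineP p.1 k = 0) (w : ℕ → ℤ × ℤ) :
    (l1 (post (lineP p.1 + w)).1 p.1 : ℝ≥0∞) ≤ 2 * errB d w := by
  classical
  rw [l1_eq_dline (post (lineP p.1 + w)).2 p.2]
  have hT := Nat.find_spec (exists_haltPred (lineP p.1 + w))
  have hmin := fun k => Nat.find_min (exists_haltPred (lineP p.1 + w)) (m := k)
  have hb := dline_trunc_le p.2 d hd w _ hT (fun k hk => hmin k hk)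
  refine (dline_triangle _ (truncAt (Nat.find (exists_haltPred (lineP p.1 + w))) (lineP p.1 + w)) _).trans ?_
  rw [two_mul]
  refine add_le_add (le_trans ?_ hb) hb
  have := bestAt_le (Nat.find (exists_haltPred (lineP p.1 + w))) (lineP p.1 + w) p
  unfold post
  convert this

instance : MeasurableSpace IntPart := ⊤

instance : DiscreteMeasurableSpace IntPart := ⟨fun _ => trivial⟩

instance : Countable IntPart := by
  have : Function.Injective (fun p : IntPart => Finsupp.ofSupportFinite p.1 p.2.2) := by
    intro p q h
    apply Subtype.ext
    funext i
    exact DFunLike.congr_fun h i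
  exact this.countable

lemma measurable_post : Measurable post := by
  classical
  have hs : ∀ k, MeasurableSet {y : ℕ → ℤ × ℤ | haltAt y k} := by
    intro k
    have : {y : ℕ → ℤ × ℤ | haltAt y k} = (fun y : ℕ → ℤ × ℤ => y k) ⁻¹' {z | z.1 ≤ 0 ∧ z.2 ≤ 0} := rfl
    rw [this]
    exact measurable_pi_apply k (Set.to_countable _).measurableSet
  refine Measurable.find (f := bestAt) (p := haltPred) ?_ ?_ exists_haltPred
  · intro T
    have h1 : Measurable (bestFin T) := measurable_of_countable _
    have h2 : Measurable (fun (y : ℕ → ℤ × ℤ) (i : Fin T) => y i) := by fun_prop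
    exact h1.comp h2
  · intro k
    have : {y | haltPred k y} = {y | haltAt y k} ∪ ⋂ j, {y | haltAt y j}ᶜ := by
      ext y
      simp [haltPred]
    rw [this]
    exact (hs k).union (MeasurableSet.iInter fun j => (hs j).compl)

/-! ### Noise -/

open MeasureTheory

lemma HasSum.congr_fun' {α : Type*} {f g : α → ℝ} {s : ℝ} (h : HasSum f s)
    (hfg : ∀ a, g a = f a) : HasSum g s := by
  rwa [show g = f from funext hfg]

lemma HasSum.congr_val' {α : Type*} {f : α → ℝ} {s t : ℝ} (h : HasSum f s)
    (hst : t = s) : HasSum f t := by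
  rwa [hst]

lemma hasSum_sq_geom {r : ℝ} (h0 : 0 ≤ r) (h1 : r < 1) :
    HasSum (fun n : ℕ => (n : ℝ) ^ 2 * r ^ n) (r * (1 + r) / (1 - r) ^ 3) := by
  have hn : ‖r‖ < 1 := by rwa [Real.norm_of_nonneg h0]
  have a2 := (hasSum_choose_mul_geometric_of_norm_lt_one 2 hn).mul_left 2
  have a1 := (hasSum_choose_mul_geometric_of_norm_lt_one 1 hn).mul_left 3
  have a0 := hasSum_geometric_of_norm_lt_one hn
  have h := (a2.sub a1).add a0
  have hr : (1 - r) ≠ 0 := by linarith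
  refine (h.congr_fun' ?_).congr_val' ?_
  · intro n
    have : ((n + 2).choose 2 : ℝ) = (n + 2) * (n + 1) / 2 := by
      rw [Nat.cast_choose_two]; push_cast; ring
    rw [this]
    simp
    ring
  · field_simp
    ring

lemma hasSum_int_of_nat {g : ℕ → ℝ} {s : ℝ} (h : HasSum g s) :
    HasSum (fun z : ℤ => g z.natAbs) (s + (s - g 0)) := by
  have h2 : HasSum (fun n : ℕ => g (n + 1)) (s - g 0) := by
    have := (hasSum_nat_add_iff' 1).2 h
    simpa using this
  refine HasSum.of_nat_of_neg_add_one (f := fun z : ℤ => g z.natAbs) (by simpa using h) ?_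
  convert h2 using 3 with n
  omega

/-- Weight of the discrete Laplace distribution. -/
noncomputable def lapW (r : ℝ) (z : ℤ) : ℝ := (1 - r) / (1 + r) * r ^ z.natAbs

lemma lapW_nonneg {r : ℝ} (h0 : 0 ≤ r) (h1 : r < 1) (z : ℤ) : 0 ≤ lapW r z := by
  unfold lapW
  have : 0 ≤ 1 - r := by linarith
  positivity

lemma hasSum_lapW {r : ℝ} (h0 : 0 ≤ r) (h1 : r < 1) : HasSum (lapW r) 1 := by
  have h := (hasSum_int_of_nat (hasSum_geometric_of_lt_one h0 h1)).mul_left ((1 - r) / (1 + r))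
  have hr : (1 - r) ≠ 0 := by linarith
  have hr' : (1 + r) ≠ 0 := by linarith
  refine (h.congr_fun' fun z => rfl).congr_val' ?_
  field_simp
  ring

lemma hasSum_lapW_sq {r : ℝ} (h0 : 0 ≤ r) (h1 : r < 1) :
    HasSum (fun z : ℤ => lapW r z * (z.natAbs : ℝ) ^ 2) (2 * r / (1 - r) ^ 2) := by
  have h := (hasSum_int_of_nat (hasSum_sq_geom h0 h1)).mul_left ((1 - r) / (1 + r))
  have hr : (1 - r) ≠ 0 := by linarith
  have hr' : (1 + r) ≠ 0 := by linarith
  refine (h.congr_fun' ?_).congr_val' ?_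
  · intro z
    unfold lapW
    ring
  · field_simp
    simp
    ring

lemma hasSum_ofReal {α : Type*} {f : α → ℝ} {s : ℝ} (h0 : ∀ a, 0 ≤ f a) (h : HasSum f s) :
    HasSum (fun a => ENNReal.ofReal (f a)) (ENNReal.ofReal s) := by
  rw [← h.tsum_eq, ENNReal.ofReal_tsum_of_nonneg h0 h.summable]
  exact ENNReal.summable.hasSum

/-- The discrete Laplace distribution. -/
noncomputable def lapP (r : ℝ) (h0 : 0 ≤ r) (h1 : r < 1) : PMF ℤ :=
  ⟨fun z => ENNReal.ofReal (lapW r z), by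
    simpa using hasSum_ofReal (lapW_nonneg h0 h1) (hasSum_lapW h0 h1)⟩

/-- The noise of one line. -/
noncomputable def lineNoise (r : ℝ) (h0 : 0 ≤ r) (h1 : r < 1) : Measure (ℤ × ℤ) :=
  (lapP r h0 h1).toMeasure.prod (lapP r h0 h1).toMeasure

instance (r : ℝ) (h0 : 0 ≤ r) (h1 : r < 1) : IsProbabilityMeasure (lineNoise r h0 h1) := by
  unfold lineNoise; infer_instance

lemma lineNoise_singleton (r : ℝ) (h0 : 0 ≤ r) (h1 : r < 1) (z : ℤ × ℤ) :
    lineNoise r h0 h1 {z} = ENNReal.ofReal (((1 - r) / (1 + r)) ^ 2 * r ^ nrm z) := by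
  have : ({z} : Set (ℤ × ℤ)) = {z.1} ×ˢ {z.2} := by simp
  unfold lineNoise
  rw [this, Measure.prod_prod, PMF.toMeasure_apply_singleton _ _ (measurableSet_singleton _),
    PMF.toMeasure_apply_singleton _ _ (measurableSet_singleton _)]
  change ENNReal.ofReal (lapW r z.1) * ENNReal.ofReal (lapW r z.2) = _
  rw [← ENNReal.ofReal_mul (lapW_nonneg h0 h1 _)]
  congr 1
  unfold lapW nrm
  ring

lemma lintegral_pot (r : ℝ) (h0 : 0 ≤ r) (h1 : r < 1) :
    ∫⁻ z, (pot z : ℝ≥0∞) ∂(lineNoise r h0 h1) = ENNReal.ofReal (4 * r / (1 - r) ^ 2) := by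
  have h2 : ∫⁻ z : ℤ, (z.natAbs : ℝ≥0∞) ^ 2 ∂(lapP r h0 h1).toMeasure
      = ENNReal.ofReal (2 * r / (1 - r) ^ 2) := by
    rw [lintegral_countable', ← (hasSum_ofReal (fun z => mul_nonneg (lapW_nonneg h0 h1 z) (sq_nonneg _))
      (hasSum_lapW_sq h0 h1)).tsum_eq]
    refine tsum_congr fun z => ?_
    rw [PMF.toMeasure_apply_singleton _ _ (measurableSet_singleton _), ENNReal.ofReal_mul (lapW_nonneg h0 h1 z),
      mul_comm, ENNReal.ofReal_pow (by positivity), ENNReal.ofReal_natCast]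
    rfl
  have hm : Measurable (fun z : ℤ => (z.natAbs : ℝ≥0∞) ^ 2) := measurable_of_countable _
  have e : ∀ z : ℤ × ℤ, (pot z : ℝ≥0∞) = (z.1.natAbs : ℝ≥0∞) ^ 2 + (z.2.natAbs : ℝ≥0∞) ^ 2 := by
    intro z; simp [pot]
  simp_rw [e]
  rw [lintegral_add_left (measurable_of_countable _)]
  unfold lineNoise
  rw [(measurePreserving_fst (μ := (lapP r h0 h1).toMeasure) (ν := (lapP r h0 h1).toMeasure)).lintegral_comp hm,
    (measurePreserving_snd (μ := (lapP r h0 h1).toMeasure) (ν := (lapP r h0 h1).toMeasure)).lintegral_comp hm,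
    h2, ← ENNReal.ofReal_add (by positivity) (by positivity)]
  congr 1
  ring

lemma lineNoise_shift (r : ℝ) (h0 : 0 < r) (h1 : r < 1) (a b : ℤ × ℤ) (hab : nrm (a - b) ≤ 1) :
    (lineNoise r h0.le h1).map (fun z => a + z)
      ≤ ENNReal.ofReal r⁻¹ • (lineNoise r h0.le h1).map (fun z => b + z) := by
  have hsing : ∀ c z : ℤ × ℤ, (lineNoise r h0.le h1).map (fun z => c + z) {z}
      = ENNReal.ofReal (((1 - r) / (1 + r)) ^ 2 * r ^ nrm (z - c)) := by
    intro c z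
    rw [Measure.map_apply (measurable_of_countable _) (measurableSet_singleton _), ← lineNoise_singleton r h0.le h1]
    congr 1
    ext y
    simp only [Set.mem_preimage, Set.mem_singleton_iff]
    constructor
    · rintro rfl; abel
    · rintro rfl; abel
  intro s
  rw [← Measure.tsum_indicator_apply_singleton _ s (Set.to_countable s).measurableSet,
    ← Measure.tsum_indicator_apply_singleton _ s (Set.to_countable s).measurableSet]
  refine ENNReal.tsum_le_tsum fun z => ?_
  refine Set.indicator_le_indicator ?_
  rw [Measure.smul_apply, hsing, hsing, smul_eq_mul, ← ENNReal.ofReal_mul (by positivity)]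
  refine ENNReal.ofReal_le_ofReal ?_
  have hle : nrm (z - b) ≤ nrm (z - a) + 1 := by
    simp only [nrm, Prod.fst_sub, Prod.snd_sub] at hab ⊢
    omega
  have hp : r ^ (nrm (z - a) + 1) ≤ r ^ nrm (z - b) := pow_le_pow_of_le_one h0.le h1.le hle
  have hq : r ^ nrm (z - a) ≤ r⁻¹ * r ^ nrm (z - b) := by
    calc r ^ nrm (z - a) = r⁻¹ * r ^ (nrm (z - a) + 1) := by rw [pow_succ]; field_simp
      _ ≤ _ := by gcongr
  calc ((1 - r) / (1 + r)) ^ 2 * r ^ nrm (z - a)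
      ≤ ((1 - r) / (1 + r)) ^ 2 * (r⁻¹ * r ^ nrm (z - b)) := by gcongr
    _ = _ := by ring

/-- Changing one factor of an infinite product measure. -/
lemma infinitePi_le {X : Type*} [MeasurableSpace X] (μ μ' : ℕ → Measure X)
    [∀ i, IsProbabilityMeasure (μ i)] [∀ i, IsProbabilityMeasure (μ' i)] (c : ℝ≥0∞) (hc : c ≠ ⊤) (k : ℕ)
    (heq : ∀ i, i ≠ k → μ i = μ' i) (hle : μ k ≤ c • μ' k) :
    Measure.infinitePi μ ≤ c • Measure.infinitePi μ' := by
  classical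
  have hmeas : Measurable (fun z : X × (ℕ → X) => Function.update z.2 k z.1) := by
    rw [measurable_pi_iff]
    intro i
    by_cases hi : i = k
    · subst hi
      simpa using measurable_fst
    · simp only [Function.update_of_ne hi]
      fun_prop
  have key : ∀ ρ : ℕ → Measure X, ∀ [∀ i, IsProbabilityMeasure (ρ i)], (∀ i, i ≠ k → ρ i = μ' i) →
      ((ρ k).prod (Measure.infinitePi μ')).map (fun z : X × (ℕ → X) => Function.update z.2 k z.1)
        = Measure.infinitePi ρ := by
    intro ρ _ hρ
    refine Measure.eq_infinitePi _ fun s t ht => ?_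
    rw [Measure.map_apply hmeas (MeasurableSet.pi s.countable_toSet fun i _ => ht i)]
    have hpre : (fun z : X × (ℕ → X) => Function.update z.2 k z.1) ⁻¹' (Set.pi s t)
        = (if k ∈ s then t k else Set.univ) ×ˢ (Set.pi (s.erase k : Finset ℕ) t) := by
      ext ⟨x, ω⟩
      simp only [Set.mem_preimage, Set.mem_pi, Set.mem_prod, Finset.mem_coe, Finset.mem_erase]
      constructor
      · intro h
        refine ⟨?_, fun i hi => ?_⟩
        · split_ifs with hk
          · simpa using h k hk
          · trivial
        · simpa [Function.update_of_ne hi.1] using h i hi.2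
      · rintro ⟨h1, h2⟩ i hi
        by_cases hik : i = k
        · subst hik
          rw [if_pos hi] at h1
          simpa using h1
        · simpa [Function.update_of_ne hik] using h2 i ⟨hik, hi⟩
    rw [hpre, Measure.prod_prod, Measure.infinitePi_pi _ (fun i _ => ht i)]
    have hpe : ∏ i ∈ s.erase k, μ' i (t i) = ∏ i ∈ s.erase k, ρ i (t i) :=
      Finset.prod_congr rfl fun i hi => by rw [hρ i (Finset.ne_of_mem_erase hi)]
    rw [hpe]
    split_ifs with hk
    · rw [Finset.mul_prod_erase s (fun i => ρ i (t i)) hk]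
    · rw [Finset.erase_eq_of_notMem hk]
      simp
  rw [← key μ heq]
  refine le_trans ?_ (le_of_eq (congrArg (fun ρ => c • ρ) (key μ' (fun _ _ => rfl))))
  rw [← Measure.map_smul]
  refine Measure.map_mono ?_ hmeas
  rw [← Measure.prod_smul_left]
  exact Measure.prod_mono hle le_rfl

lemma single_change {x y : ℕ → ℤ × ℤ} (h : dline x y ≤ 1) :
    ∃ k, nrm (x k - y k) ≤ 1 ∧ ∀ i, i ≠ k → x i = y i := by
  have hz : ∀ i, nrm (x i - y i) = 0 → x i = y i := by
    intro i hi
    simp only [nrm, Prod.fst_sub, Prod.snd_sub] at hi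
    ext <;> omega
  by_cases hex : ∃ k, nrm (x k - y k) ≠ 0
  · obtain ⟨k, hk⟩ := hex
    refine ⟨k, ?_, fun i hi => hz i ?_⟩
    · have := (ENNReal.le_tsum (f := fun k => (nrm (x k - y k) : ℝ≥0∞)) k).trans h
      exact_mod_cast this
    · have := (ENNReal.sum_le_tsum (f := fun k => (nrm (x k - y k) : ℝ≥0∞)) {i, k}).trans h
      rw [Finset.sum_pair hi] at this
      have h3 : nrm (x i - y i) + nrm (x k - y k) ≤ 1 := by exact_mod_cast this
      omega
  · push Not at hex
    exact ⟨0, by rw [hex 0]; omega, fun i _ => hz i (hex i)⟩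

lemma lintegral_errB (κ : Measure (ℤ × ℤ)) [IsProbabilityMeasure κ] (d : ℕ) :
    ∫⁻ w, errB d w ∂(Measure.infinitePi (fun _ : ℕ => κ))
      = 2 * (d * ∫⁻ z, (pot z : ℝ≥0∞) ∂κ) + ∑' i : ℕ, (∫⁻ z, (pot z : ℝ≥0∞) ∂κ) ^ (i + 1) := by
  have hm : Measurable (fun z : ℤ × ℤ => (pot z : ℝ≥0∞)) := measurable_of_countable _
  have hmk : ∀ k, Measurable (fun w : ℕ → ℤ × ℤ => (pot (w k) : ℝ≥0∞)) := fun k =>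
    hm.comp (measurable_pi_apply k)
  have h1 : ∀ k, ∫⁻ w, (pot (w k) : ℝ≥0∞) ∂(Measure.infinitePi (fun _ : ℕ => κ))
      = ∫⁻ z, (pot z : ℝ≥0∞) ∂κ := fun k =>
    (measurePreserving_eval_infinitePi (fun _ : ℕ => κ) k).lintegral_comp hm
  unfold errB
  rw [lintegral_add_left (by fun_prop), lintegral_const_mul _ (by fun_prop),
    lintegral_finsetSum _ (fun k _ => hmk k), lintegral_tsum (fun i => (Finset.measurable_fun_prod _ fun k _ => hmk k).aemeasurable)]
  congr 1
  · simp [h1]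
  · refine tsum_congr fun i => ?_
    rw [ProbabilityTheory.lintegral_prod_eq_prod_lintegral_of_indepFun (Finset.Ico d (d + i + 1))
      (fun k (w : ℕ → ℤ × ℤ) => (pot (w k) : ℝ≥0∞))
      (ProbabilityTheory.iIndepFun_infinitePi (X := fun _ z => (pot z : ℝ≥0∞)) (fun _ => hm)) hmk]
    simp [h1, add_assoc]

/-- The mechanism as a measure. -/
noncomputable def mechM (r : ℝ) (h0 : 0 ≤ r) (h1 : r < 1) (p : IntPart) : Measure IntPart :=
  (Measure.infinitePi (fun _ : ℕ => lineNoise r h0 h1)).map (fun w => post (lineP p.1 + w))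

lemma measurable_mech (p : IntPart) : Measurable (fun w => post (lineP p.1 + w)) :=
  measurable_post.comp (by
    rw [measurable_pi_iff]
    intro k
    exact (measurable_of_countable (fun z : ℤ × ℤ => lineP p.1 k + z)).comp (measurable_pi_apply k))

instance (r : ℝ) (h0 : 0 ≤ r) (h1 : r < 1) (p : IntPart) :
    IsProbabilityMeasure (mechM r h0 h1 p) :=
  Measure.isProbabilityMeasure_map (measurable_mech p).aemeasurable

lemma mechM_dp (r : ℝ) (h0 : 0 < r) (h1 : r < 1) (p p' : IntPart) (h : l1 p.1 p'.1 ≤ 1) :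
    mechM r h0.le h1 p ≤ ENNReal.ofReal r⁻¹ • mechM r h0.le h1 p' := by
  have hm : ∀ c : ℤ × ℤ, Measurable (fun z : ℤ × ℤ => c + z) := fun c => measurable_of_countable _
  have e : ∀ p : IntPart, mechM r h0.le h1 p
      = (Measure.infinitePi (fun k : ℕ => (lineNoise r h0.le h1).map (fun z => lineP p.1 k + z))).map post := by
    intro p
    rw [← Measure.infinitePi_map_pi _ (fun k => hm _), Measure.map_map measurable_post]
    · rfl
    · rw [measurable_pi_iff]
      intro k
      exact (hm _).comp (measurable_pi_apply k)
  rw [e, e, ← Measure.map_smul]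
  refine Measure.map_mono ?_ measurable_post
  have hd : dline (lineP p.1) (lineP p'.1) ≤ 1 := by
    rw [← l1_eq_dline p.2 p'.2]
    exact_mod_cast h
  obtain ⟨k, hk, hne⟩ := single_change hd
  have inst : ∀ p : IntPart, ∀ k, IsProbabilityMeasure
      ((lineNoise r h0.le h1).map (fun z => lineP p.1 k + z)) := fun p k =>
    Measure.isProbabilityMeasure_map (hm _).aemeasurable
  have := inst p
  have := inst p'
  refine infinitePi_le _ _ _ ENNReal.ofReal_ne_top k (fun i hi => ?_) ?_
  · rw [hne i hi]
  · exact lineNoise_shift r h0 h1 _ _ hk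

lemma mechM_err (r : ℝ) (h0 : 0 < r) (h1 : r ≤ 1 / 7) (p : IntPart) (d : ℕ)
    (hd : ∀ k, d ≤ k → lineP p.1 k = 0) :
    ∑' q : IntPart, (mechM r h0.le (by linarith) p).toPMF q * (l1 q.1 p.1 : ℝ≥0∞)
      ≤ ENNReal.ofReal ((22 * d + 50) * r) := by
  have h1' : r < 1 := by linarith
  set m : ℝ := 4 * r / (1 - r) ^ 2 with hmdef
  have hm0 : 0 ≤ m := by positivity
  have hmr : m ≤ 49 / 9 * r := by
    rw [hmdef, div_le_iff₀ (by nlinarith)]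
    have : (36 : ℝ) / 49 ≤ (1 - r) ^ 2 := by nlinarith
    nlinarith
  have hm1 : m ≤ 7 / 9 := by linarith
  have hE := lintegral_pot r h0.le h1'
  calc ∑' q : IntPart, (mechM r h0.le h1' p).toPMF q * (l1 q.1 p.1 : ℝ≥0∞)
      = ∫⁻ q, (l1 q.1 p.1 : ℝ≥0∞) ∂(mechM r h0.le h1' p) := by
        rw [lintegral_countable']
        refine tsum_congr fun q => ?_
        rw [Measure.toPMF_apply, mul_comm]
    _ = ∫⁻ w, (l1 (post (lineP p.1 + w)).1 p.1 : ℝ≥0∞)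
          ∂(Measure.infinitePi (fun _ : ℕ => lineNoise r h0.le h1')) := by
        unfold mechM
        rw [lintegral_map (measurable_of_countable _) (measurable_mech p)]
    _ ≤ ∫⁻ w, 2 * errB d w ∂(Measure.infinitePi (fun _ : ℕ => lineNoise r h0.le h1')) :=
        lintegral_mono fun w => post_error p d hd w
    _ = 2 * ∫⁻ w, errB d w ∂(Measure.infinitePi (fun _ : ℕ => lineNoise r h0.le h1')) :=
        lintegral_const_mul' _ _ (by simp)
    _ = 2 * (2 * (d * ENNReal.ofReal m) + ∑' i : ℕ, ENNReal.ofReal m ^ (i + 1)) := by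
        rw [lintegral_errB, hE]
    _ = ENNReal.ofReal (2 * (2 * (d * m) + m / (1 - m))) := by
        have hs : HasSum (fun i : ℕ => m ^ (i + 1)) (m / (1 - m)) := by
          have := (hasSum_geometric_of_lt_one hm0 (by linarith)).mul_left m
          simpa [pow_succ', div_eq_mul_inv] using this
        have h3 : ∑' i : ℕ, ENNReal.ofReal m ^ (i + 1) = ENNReal.ofReal (m / (1 - m)) := by
          rw [← (hasSum_ofReal (fun i => by positivity) hs).tsum_eq]
          refine tsum_congr fun i => ?_
          rw [ENNReal.ofReal_pow hm0]
        have h4 : 0 ≤ m / (1 - m) := div_nonneg hm0 (by linarith)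
        rw [h3, ENNReal.ofReal_mul (by norm_num), ENNReal.ofReal_add (by positivity) h4,
          ENNReal.ofReal_mul (by norm_num), ENNReal.ofReal_mul (by positivity)]
        simp
    _ ≤ ENNReal.ofReal ((22 * d + 50) * r) := by
        refine ENNReal.ofReal_le_ofReal ?_
        have h5 : m / (1 - m) ≤ 9 / 2 * m := by
          rw [div_le_iff₀ (by linarith)]
          nlinarith
        have h6 : (d : ℝ) * m ≤ d * (49 / 9 * r) := by gcongr
        have h7 : 0 ≤ (d : ℝ) * r := by positivity
        nlinarith

/-- Algorithm for unknown `n`: there are absolute constants `C, c > 0` such that for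
every `ε ≥ 2` there is an `ε`-DP algorithm `A : I → PMF(I)` whose expected ℓ1-error on
any integer partition `p` of size `n` is at most `C·(√n·e^{−ε} + e^{−c·n})`. -/
theorem unknown_n_upper_bound :
    ∃ C c : ℝ, 0 < C ∧ 0 < c ∧
      ∀ ε : ℝ, 2 ≤ ε →
        ∃ A : IntPart → PMF IntPart,
          (∀ p p' : IntPart, l1 p.1 p'.1 ≤ 1 → ∀ S : Set IntPart,
            (A p).toOuterMeasure S ≤
              ENNReal.ofReal (Real.exp ε) * (A p').toOuterMeasure S) ∧
          (∀ p : IntPart,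
            (∑' q : IntPart, A p q * (l1 q.1 p.1 : ℝ≥0∞)) ≤
              ENNReal.ofReal
                (C * (Real.sqrt (psize p.1) * Real.exp (-ε) +
                  Real.exp (-(c * (psize p.1 : ℝ)))))) := by
  refine ⟨100, 1, by norm_num, by norm_num, fun ε hε => ?_⟩
  set r : ℝ := Real.exp (-ε) with hr
  have h0 : 0 < r := Real.exp_pos _
  have h7 : r ≤ 1 / 7 := by
    have h1 : r ≤ Real.exp (-2) := Real.exp_le_exp.2 (by linarith)
    have h2 : (7 : ℝ) ≤ Real.exp 2 := by
      have e : Real.exp 2 = Real.exp 1 * Real.exp 1 := by rw [← Real.exp_add]; norm_num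
      have := Real.exp_one_gt_d9
      rw [e]
      nlinarith
    rw [Real.exp_neg] at h1
    refine h1.trans ?_
    rw [← one_div]
    exact one_div_le_one_div_of_le (by norm_num) h2
  have h1 : r < 1 := by linarith
  refine ⟨fun p => (mechM r h0.le h1 p).toPMF, fun p p' hpp S => ?_, fun p => ?_⟩
  · have h := mechM_dp r h0 h1 p p' hpp S
    have hinv : r⁻¹ = Real.exp ε := by rw [hr, Real.exp_neg, inv_inv]
    rw [hinv, Measure.smul_apply, smul_eq_mul] at h
    rw [← PMF.toMeasure_apply_eq_toOuterMeasure, ← PMF.toMeasure_apply_eq_toOuterMeasure,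
      Measure.toPMF_toMeasure, Measure.toPMF_toMeasure]
    exact h
  · obtain ⟨d, hd2, hd⟩ := exists_durfee p.2
    refine (mechM_err r h0 h7 p d hd).trans (ENNReal.ofReal_le_ofReal ?_)
    have hds : (d : ℝ) ≤ Real.sqrt (psize p.1) := by
      refine Real.le_sqrt_of_sq_le ?_
      rw [sq]
      exact_mod_cast hd2
    have hexp : 0 < Real.exp (-(1 * (psize p.1 : ℝ))) := Real.exp_pos _
    rcases Nat.eq_zero_or_pos (psize p.1) with hz | hpos
    · have hd0 : d = 0 := by
        rw [hz] at hd2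
        nlinarith
      rw [hz, hd0]
      simp
      linarith
    · have hs1 : (1 : ℝ) ≤ Real.sqrt (psize p.1) := by
        rw [Real.one_le_sqrt]
        exact_mod_cast hpos
      have a1 : (d : ℝ) * r ≤ Real.sqrt (psize p.1) * r := by gcongr
      have a2 : 1 * r ≤ Real.sqrt (psize p.1) * r := by gcongr
      nlinarith
end
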